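/- arXiv:1901.09744 — 2 statements merged into one kernel-verified Lean document; each statement's English description precedes it below -/
import Mathlib

section
/- For the degree sequence d = (m, m, 1,...,1) on n vertices with m = ⌊√(an)⌋ and a > 0 fixed, the probability that the uniform random simple graph G(n,d) contains the edge {1,2} converges to a/(1+a) as n → ∞ (n even). -/
open Finset SimpleGraph Filter

/-- `m = ⌊√(a n)⌋` with `n = 2k + 2`. -/
noncomputable def mdeg (a : ℝ) (k : ℕ) : ℕ := ⌊Real.sqrt (a * (2 * k + 2))⌋₊

/-- The degree sequence `(m, m, 1, …, 1)` on `n = 2k + 2` vertices. -/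
noncomputable def dseq (a : ℝ) (k : ℕ) : Fin (2 * k + 2) → ℕ :=
  fun i => if (i : ℕ) < 2 then mdeg a k else 1

/-- `G` has degree sequence `(m, m, 1, …, 1)`. -/
def DegCond (a : ℝ) (k : ℕ) (G : SimpleGraph (Fin (2 * k + 2))) : Prop :=
  ∀ i, (G.neighborSet i).ncard = dseq a k i

section Auxiliary

open scoped symmDiff Classical

section Switching

variable {V : Type*}

/-- The closed walk `x - u - v - y - x` as a graph. -/
def fourCycle (x u v y : V) : SimpleGraph V :=
  edge x u ⊔ edge u v ⊔ edge v y ⊔ edge y x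

lemma fourCycle_adj (x u v y i j : V) : (fourCycle x u v y).Adj i j ↔
    ((i = x ∧ j = u ∨ i = u ∧ j = x) ∨ (i = u ∧ j = v ∨ i = v ∧ j = u) ∨
      (i = v ∧ j = y ∨ i = y ∧ j = v) ∨ (i = y ∧ j = x ∨ i = x ∧ j = y)) ∧ i ≠ j := by
  simp only [fourCycle, sup_adj, edge_adj]
  tauto

lemma fourCycle_rotate (x u v y : V) : fourCycle u v y x = fourCycle x u v y := by
  ext i j
  simp only [fourCycle_adj]
  tauto

lemma symmDiff_adj (G H : SimpleGraph V) (i j : V) :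
    (G ∆ H).Adj i j ↔ (G.Adj i j ∧ ¬ H.Adj i j) ∨ (H.Adj i j ∧ ¬ G.Adj i j) := by
  simp [symmDiff, sup_adj, sdiff_adj]

/-- Exchanging one element for another preserves the cardinality. -/
lemma ncard_eq_of_exchange [Finite V] {S T : Set V} {p q : V} (hp : p ∈ S) (hq : q ∉ S)
    (hT : ∀ z, z ∈ T ↔ (z ∈ S ∧ z ≠ p) ∨ z = q) : T.ncard = S.ncard := by
  have : T = insert q (S \ {p}) := by
    ext z; simp [hT]; tauto
  rw [this, Set.ncard_exchange hq hp]

/-- Switching along an alternating 4-cycle preserves all degrees. -/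
lemma ncard_neighborSet_symmDiff_fourCycle [Finite V] (G : SimpleGraph V) {x u v y : V}
    (hxv : x ≠ v) (huy : u ≠ y) (huv : u ≠ v) (hxy : x ≠ y)
    (h1 : G.Adj x u) (h2 : ¬ G.Adj u v) (h3 : G.Adj v y) (h4 : ¬ G.Adj y x) (i : V) :
    ((G ∆ fourCycle x u v y).neighborSet i).ncard = (G.neighborSet i).ncard := by
  have hxu := h1.ne
  have hvy := h3.ne
  have key : ∀ j, (G ∆ fourCycle x u v y).Adj i j ↔
      (G.Adj i j ∧ ¬ (fourCycle x u v y).Adj i j) ∨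
      ((fourCycle x u v y).Adj i j ∧ ¬ G.Adj i j) := symmDiff_adj _ _ i
  simp only [fourCycle_adj] at key
  have h1' := h1.symm
  have h3' := h3.symm
  have h2' : ¬ G.Adj v u := fun h => h2 h.symm
  have h4' : ¬ G.Adj x y := fun h => h4 h.symm
  by_cases hix : i = x
  · subst hix
    refine ncard_eq_of_exchange (p := u) (q := y) h1 h4' fun z => ?_
    simp only [mem_neighborSet, key]
    grind
  by_cases hiu : i = u
  · subst hiu
    refine ncard_eq_of_exchange (p := x) (q := v) h1' h2 fun z => ?_
    simp only [mem_neighborSet, key]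
    grind
  by_cases hiv : i = v
  · subst hiv
    refine ncard_eq_of_exchange (p := y) (q := u) h3 h2' fun z => ?_
    simp only [mem_neighborSet, key]
    grind
  by_cases hiy : i = y
  · subst hiy
    refine ncard_eq_of_exchange (p := v) (q := x) h3' h4 fun z => ?_
    simp only [mem_neighborSet, key]
    grind
  · congr 1
    ext z
    simp only [mem_neighborSet, key]
    grind

variable [Fintype V]

lemma card_filter_adj (G : SimpleGraph V) (i : V) :
    #{u | G.Adj i u} = (G.neighborSet i).ncard := by
  rw [← Set.ncard_coe_finset]
  congr 1
  ext z
  simp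

lemma eq_of_ncard_neighborSet_eq_one {G : SimpleGraph V} {z p q : V}
    (hz : (G.neighborSet z).ncard = 1) (hp : G.Adj z p) (hq : G.Adj z q) : p = q :=
  (Set.ncard_le_one (Set.toFinite _)).mp hz.le p hp q hq

/-- In a graph with an edge between two hubs `x` and `y` of degree `m` and all other degrees one,
the darts avoiding both hubs are counted by their first endpoint. -/
lemma card_darts_avoiding_hubs {G : SimpleGraph V} {x y : V} {m : ℕ}
    (hx : (G.neighborSet x).ncard = m) (hy : (G.neighborSet y).ncard = m)
    (hl : ∀ z, z ≠ x → z ≠ y → (G.neighborSet z).ncard = 1) (hxy : G.Adj x y) :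
    #{p : V × V | G.Adj p.1 p.2 ∧ p.1 ≠ x ∧ p.1 ≠ y ∧ p.2 ≠ x ∧ p.2 ≠ y} =
      Fintype.card V - 2 * m := by
  have hdisj : Disjoint ({u | G.Adj x u} : Finset V) ({u | G.Adj y u} : Finset V) := by
    rw [Finset.disjoint_left]
    intro z hz hz'
    simp only [mem_filter, mem_univ, true_and] at hz hz'
    exact hxy.ne (eq_of_ncard_neighborSet_eq_one (hl z hz.ne' hz'.ne') hz.symm hz'.symm)
  have hc : #((({u | G.Adj x u} : Finset V) ∪ ({u | G.Adj y u} : Finset V))ᶜ) =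
      Fintype.card V - 2 * m := by
    rw [card_compl, card_union_of_disjoint hdisj, card_filter_adj, card_filter_adj, hx, hy,
      two_mul]
  rw [← hc]
  refine card_bij (fun p _ => p.1) ?_ ?_ ?_
  · rintro ⟨u, v⟩ h
    simp only [mem_filter, mem_univ, true_and] at h
    obtain ⟨huv, hux, huy, hvx, hvy⟩ := h
    have hu := hl u hux huy
    simp only [mem_compl, mem_union, mem_filter, mem_univ, true_and, not_or]
    exact ⟨fun h => hvx (eq_of_ncard_neighborSet_eq_one hu huv h.symm),
      fun h => hvy (eq_of_ncard_neighborSet_eq_one hu huv h.symm)⟩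
  · rintro ⟨u, v⟩ h ⟨u', v'⟩ h' e
    simp only [mem_filter, mem_univ, true_and] at h h' e
    subst e
    rw [eq_of_ncard_neighborSet_eq_one (hl u h.2.1 h.2.2.1) h.1 h'.1]
  · intro u hu
    simp only [mem_compl, mem_union, mem_filter, mem_univ, true_and, not_or] at hu
    have hux : u ≠ x := by rintro rfl; exact hu.2 hxy.symm
    have huy : u ≠ y := by rintro rfl; exact hu.1 hxy
    obtain ⟨v, hv⟩ := Set.ncard_eq_one.mp (hl u hux huy)
    have huv : G.Adj u v := by
      rw [← mem_neighborSet, hv]; rfl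
    refine ⟨(u, v), ?_, rfl⟩
    simp only [mem_filter, mem_univ, true_and]
    refine ⟨huv, hux, huy, ?_, ?_⟩
    · rintro rfl; exact hu.1 huv.symm
    · rintro rfl; exact hu.2 huv.symm

/-- Double counting of switchings between graphs without and with an edge between the two hubs. -/
lemma card_mul_sq_eq_card_mul_sub {x y : V} {m : ℕ} (hne : x ≠ y) (d : V → ℕ)
    (hdx : d x = m) (hdy : d y = m) (hdl : ∀ z, z ≠ x → z ≠ y → d z = 1) :
    Nat.card {G : SimpleGraph V // (∀ i, (G.neighborSet i).ncard = d i) ∧ ¬ G.Adj x y} * m ^ 2 =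
      Nat.card {G : SimpleGraph V // (∀ i, (G.neighborSet i).ncard = d i) ∧ G.Adj x y} *
        (Fintype.card V - 2 * m) := by
  rw [Nat.subtype_card ({G : SimpleGraph V |
      (∀ i, (G.neighborSet i).ncard = d i) ∧ ¬ G.Adj x y} : Finset _) (by simp),
    Nat.subtype_card ({G : SimpleGraph V |
      (∀ i, (G.neighborSet i).ncard = d i) ∧ G.Adj x y} : Finset _) (by simp)]
  have hl : ∀ G : SimpleGraph V, (∀ i, (G.neighborSet i).ncard = d i) →
      ∀ z, z ≠ x → z ≠ y → (G.neighborSet z).ncard = 1 :=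
    fun G hG z hzx hzy => (hG z).trans (hdl z hzx hzy)
  have hL : #{G : SimpleGraph V | (∀ i, (G.neighborSet i).ncard = d i) ∧ ¬ G.Adj x y} * m ^ 2 =
      #(({G : SimpleGraph V | (∀ i, (G.neighborSet i).ncard = d i) ∧ ¬ G.Adj x y} :
        Finset (SimpleGraph V)).sigma
          fun G => ({u | G.Adj x u} : Finset V) ×ˢ ({v | G.Adj y v} : Finset V)) := by
    rw [card_sigma, sum_const_nat]
    intro G hG
    simp only [mem_filter, mem_univ, true_and] at hG
    rw [card_product, card_filter_adj, card_filter_adj, hG.1, hG.1, hdx, hdy, sq]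
  have hR : #{G : SimpleGraph V | (∀ i, (G.neighborSet i).ncard = d i) ∧ G.Adj x y} *
        (Fintype.card V - 2 * m) =
      #(({G : SimpleGraph V | (∀ i, (G.neighborSet i).ncard = d i) ∧ G.Adj x y} :
        Finset (SimpleGraph V)).sigma fun G => ({p : V × V | G.Adj p.1 p.2 ∧
          p.1 ≠ x ∧ p.1 ≠ y ∧ p.2 ≠ x ∧ p.2 ≠ y} : Finset (V × V))) := by
    rw [card_sigma, sum_const_nat]
    intro G hG
    simp only [mem_filter, mem_univ, true_and] at hG
    exact card_darts_avoiding_hubs ((hG.1 x).trans hdx) ((hG.1 y).trans hdy) (hl G hG.1) hG.2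
  rw [hL, hR]
  refine card_bij' (fun t _ => ⟨t.1 ∆ fourCycle x t.2.1 t.2.2 y, t.2⟩)
    (fun t _ => ⟨t.1 ∆ fourCycle x t.2.1 t.2.2 y, t.2⟩) ?_ ?_ ?_ ?_
  · rintro ⟨G, u, v⟩ h
    simp only [mem_sigma, mem_product, mem_filter, mem_univ, true_and] at h ⊢
    obtain ⟨⟨hG, hxy⟩, hu, hv⟩ := h
    have huy : u ≠ y := by rintro rfl; exact hxy hu
    have hvx : v ≠ x := by rintro rfl; exact hxy hv.symm
    have hu1 := hl G hG u hu.ne' huy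
    have huv : u ≠ v := by
      rintro rfl
      exact hne (eq_of_ncard_neighborSet_eq_one hu1 hu.symm hv.symm)
    have huv' : ¬ G.Adj u v := fun h =>
      hvx (eq_of_ncard_neighborSet_eq_one hu1 h hu.symm)
    refine ⟨⟨fun i => ?_, ?_⟩, ?_, hu.ne', huy, hvx, hv.ne'⟩
    · rw [ncard_neighborSet_symmDiff_fourCycle G hvx.symm huy huv hne hu huv' hv.symm
        fun h => hxy h.symm, hG]
    · rw [symmDiff_adj]
      refine Or.inr ⟨?_, hxy⟩
      simp [fourCycle_adj, hne]
    · rw [symmDiff_adj]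
      refine Or.inr ⟨?_, huv'⟩
      simp [fourCycle_adj, huv]
  · rintro ⟨G, u, v⟩ h
    simp only [mem_sigma, mem_product, mem_filter, mem_univ, true_and] at h ⊢
    obtain ⟨⟨hG, hxy⟩, huv, hux, huy, hvx, hvy⟩ := h
    have hxu : ¬ G.Adj x u := fun h =>
      hvx (eq_of_ncard_neighborSet_eq_one (hl G hG u hux huy) huv h.symm)
    have hvy' : ¬ G.Adj v y := fun h =>
      huy (eq_of_ncard_neighborSet_eq_one (hl G hG v hvx hvy) huv.symm h)
    refine ⟨⟨fun i => ?_, ?_⟩, ?_, ?_⟩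
    · rw [← fourCycle_rotate, ncard_neighborSet_symmDiff_fourCycle G huy hvx hvy hux
        huv hvy' hxy.symm hxu, hG]
    · rw [symmDiff_adj]
      have : (fourCycle x u v y).Adj x y := by simp [fourCycle_adj, hne]
      tauto
    · rw [symmDiff_adj]
      refine Or.inr ⟨?_, hxu⟩
      simp [fourCycle_adj, hux.symm]
    · rw [symmDiff_adj]
      refine Or.inr ⟨?_, fun h => hvy' h.symm⟩
      simp [fourCycle_adj, hvy.symm]
  · rintro ⟨G, u, v⟩ _
    simp
  · rintro ⟨G, u, v⟩ _
    simp

end Switching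

/-- A graph whose hubs `0` and `1` have `m` private leaves each; the other vertices are paired. -/
def twoStarsMatching (k m : ℕ) : SimpleGraph (Fin (2 * k + 2)) :=
  SimpleGraph.fromRel fun i j =>
    ((i : ℕ) = 0 ∧ 2 ≤ (j : ℕ) ∧ (j : ℕ) < m + 2) ∨
    ((i : ℕ) = 1 ∧ m + 2 ≤ (j : ℕ) ∧ (j : ℕ) < 2 * m + 2) ∨
    (2 * m + 2 ≤ (i : ℕ) ∧ (i : ℕ) % 2 = 0 ∧ (j : ℕ) = i + 1)

lemma card_fin_filter_Ico {n p q : ℕ} (hq : q ≤ n) :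
    #{j : Fin n | p ≤ (j : ℕ) ∧ (j : ℕ) < q} = q - p := by
  rw [← Nat.card_Ico, ← card_map Fin.valEmbedding]
  congr 1
  ext z
  simp only [Finset.mem_map, mem_filter, mem_univ, true_and, Fin.valEmbedding_apply, mem_Ico]
  exact ⟨by rintro ⟨j, h, rfl⟩; exact h, fun h => ⟨⟨z, by omega⟩, h, rfl⟩⟩

lemma ncard_neighborSet_twoStarsMatching {k m : ℕ} (hm : m ≤ k) (i : Fin (2 * k + 2)) :
    ((twoStarsMatching k m).neighborSet i).ncard = if (i : ℕ) < 2 then m else 1 := by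
  have hadj : ∀ p q, p ≤ q → q ≤ 2 * k + 2 →
      (∀ j : Fin (2 * k + 2), (twoStarsMatching k m).Adj i j ↔ p ≤ (j : ℕ) ∧ (j : ℕ) < q) →
      ((twoStarsMatching k m).neighborSet i).ncard = q - p := by
    intro p q hpq hq h
    rw [← card_filter_adj, ← card_fin_filter_Ico hq]
    congr 1
    ext j
    simp [h]
  have hi := i.isLt
  have key : ∀ j : Fin (2 * k + 2), (twoStarsMatching k m).Adj i j ↔ _ :=
    fun j => SimpleGraph.fromRel_adj _ i j
  simp only [ne_eq, Fin.ext_iff] at key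
  rcases (by omega : (i : ℕ) = 0 ∨ (i : ℕ) = 1 ∨ (2 ≤ (i : ℕ) ∧ (i : ℕ) < m + 2) ∨
      (m + 2 ≤ (i : ℕ) ∧ (i : ℕ) < 2 * m + 2) ∨ (2 * m + 2 ≤ (i : ℕ) ∧ (i : ℕ) % 2 = 0) ∨
      (2 * m + 2 ≤ (i : ℕ) ∧ (i : ℕ) % 2 = 1)) with h | h | h | h | h | h
  · rw [hadj 2 (m + 2) (by omega) (by omega) fun j => by rw [key]; omega]
    simp [h]
  · rw [hadj (m + 2) (2 * m + 2) (by omega) (by omega) fun j => by rw [key]; omega]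
    simp [h]; omega
  · rw [hadj 0 1 (by omega) (by omega) fun j => by rw [key]; omega, if_neg (by omega)]
  · rw [hadj 1 2 (by omega) (by omega) fun j => by rw [key]; omega, if_neg (by omega)]
  · rw [hadj (i + 1) (i + 2) (by omega) (by omega) fun j => by rw [key]; omega,
      if_neg (by omega)]
    omega
  · rw [hadj (i - 1) i (by omega) (by omega) fun j => by rw [key]; omega, if_neg (by omega)]
    omega

/-- The exact edge probability whenever `m ≤ k`. -/
lemma edge_prob_eq {a : ℝ} {k : ℕ} (hm : mdeg a k ≤ k) :
    (Nat.card {G : SimpleGraph (Fin (2 * k + 2)) //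
        DegCond a k G ∧ G.Adj ⟨0, by omega⟩ ⟨1, by omega⟩} : ℝ) /
      (Nat.card {G : SimpleGraph (Fin (2 * k + 2)) // DegCond a k G} : ℝ) =
    (mdeg a k : ℝ) ^ 2 / ((mdeg a k : ℝ) ^ 2 + (2 * k + 2 - 2 * mdeg a k)) := by
  set m := mdeg a k with hmdef
  set x : Fin (2 * k + 2) := ⟨0, by omega⟩ with hx
  set y : Fin (2 * k + 2) := ⟨1, by omega⟩ with hy
  have hsw := card_mul_sq_eq_card_mul_sub (x := x) (y := y) (m := m) (by simp [hx, hy])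
    (dseq a k) (by simp [dseq, hx, hmdef]) (by simp [dseq, hy, hmdef]) (by
      intro z hzx hzy
      simp only [hx, hy, ne_eq, Fin.ext_iff] at hzx hzy
      rw [dseq, if_neg (by omega)])
  have hsplit := card_filter_add_card_filter_not
    (s := ({G | (∀ i, (G.neighborSet i).ncard = dseq a k i)} :
      Finset (SimpleGraph (Fin (2 * k + 2))))) fun G => G.Adj x y
  rw [filter_filter, filter_filter] at hsplit
  have hpos : 0 < #{G : SimpleGraph (Fin (2 * k + 2)) |
      (∀ i, (G.neighborSet i).ncard = dseq a k i)} :=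
    card_pos.mpr ⟨twoStarsMatching k m, by
      simp only [mem_filter, mem_univ, true_and]
      exact ncard_neighborSet_twoStarsMatching hm⟩
  rw [Fintype.card_fin] at hsw
  rw [← Nat.subtype_card (p := fun G : SimpleGraph (Fin (2 * k + 2)) =>
      (∀ i, (G.neighborSet i).ncard = dseq a k i) ∧ G.Adj x y) _ (by simp),
    ← Nat.subtype_card (p := fun G : SimpleGraph (Fin (2 * k + 2)) =>
      (∀ i, (G.neighborSet i).ncard = dseq a k i) ∧ ¬ G.Adj x y) _ (by simp),
    ← Nat.subtype_card (p := fun G : SimpleGraph (Fin (2 * k + 2)) =>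
      ∀ i, (G.neighborSet i).ncard = dseq a k i) _ (by simp)] at hsplit
  rw [← Nat.subtype_card (p := fun G : SimpleGraph (Fin (2 * k + 2)) =>
      ∀ i, (G.neighborSet i).ncard = dseq a k i) _ (by simp)] at hpos
  simp only [DegCond]
  generalize Nat.card {G : SimpleGraph (Fin (2 * k + 2)) //
    (∀ i, (G.neighborSet i).ncard = dseq a k i) ∧ G.Adj x y} = N₁ at *
  generalize Nat.card {G : SimpleGraph (Fin (2 * k + 2)) //
    (∀ i, (G.neighborSet i).ncard = dseq a k i) ∧ ¬ G.Adj x y} = N₀ at *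
  generalize Nat.card {G : SimpleGraph (Fin (2 * k + 2)) //
    (∀ i, (G.neighborSet i).ncard = dseq a k i)} = N at *
  have h1 : (N₀ : ℝ) * m ^ 2 = N₁ * (2 * k + 2 - 2 * m) := by
    have := congrArg (Nat.cast : ℕ → ℝ) hsw
    rw [Nat.cast_mul, Nat.cast_mul, Nat.cast_sub (by omega)] at this
    push_cast at this
    exact this
  have h2 : (N₁ : ℝ) + N₀ = N := by exact_mod_cast hsplit
  have h3 : (0 : ℝ) < N := by exact_mod_cast hpos
  have h4 : (m : ℝ) ≤ k := by exact_mod_cast hm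
  have h5 : (0 : ℝ) < (m : ℝ) ^ 2 + (2 * k + 2 - 2 * m) := by nlinarith [sq_nonneg (m : ℝ)]
  rw [div_eq_div_iff h3.ne' h5.ne', ← h2]
  linear_combination -h1

lemma tendsto_sqrt_mul_atTop {a : ℝ} (ha : 0 < a) :
    Tendsto (fun k : ℕ => Real.sqrt (a * (2 * k + 2))) atTop atTop := by
  refine Real.tendsto_sqrt_atTop.comp (Tendsto.const_mul_atTop ha ?_)
  exact tendsto_atTop_add_const_right _ _
    (tendsto_natCast_atTop_atTop.const_mul_atTop (by norm_num))

lemma tendsto_mdeg_div_sqrt {a : ℝ} (ha : 0 < a) :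
    Tendsto (fun k : ℕ => (mdeg a k : ℝ) / Real.sqrt (a * (2 * k + 2))) atTop (nhds 1) :=
  (tendsto_nat_floor_div_atTop (R := ℝ)).comp (tendsto_sqrt_mul_atTop ha)

lemma tendsto_mdeg_sq_div {a : ℝ} (ha : 0 < a) :
    Tendsto (fun k : ℕ => (mdeg a k : ℝ) ^ 2 / (2 * k + 2)) atTop (nhds a) := by
  have h := ((tendsto_mdeg_div_sqrt ha).pow 2).const_mul a
  rw [one_pow, mul_one] at h
  refine h.congr fun k => ?_
  rw [div_pow, Real.sq_sqrt (by positivity)]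
  field_simp

lemma tendsto_mdeg_div {a : ℝ} (ha : 0 < a) :
    Tendsto (fun k : ℕ => (mdeg a k : ℝ) / (2 * k + 2)) atTop (nhds 0) := by
  have h := ((tendsto_mdeg_div_sqrt ha).mul
    (tendsto_inv_atTop_zero.comp (tendsto_sqrt_mul_atTop ha))).const_mul a
  rw [mul_zero, mul_zero] at h
  refine h.congr fun k => ?_
  have hs : Real.sqrt (a * (2 * k + 2)) * Real.sqrt (a * (2 * k + 2)) = a * (2 * k + 2) :=
    Real.mul_self_sqrt (by positivity)
  rw [Function.comp_apply, ← div_eq_mul_inv, div_div, hs]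
  field_simp

lemma eventually_mdeg_le {a : ℝ} (ha : 0 < a) : ∀ᶠ k : ℕ in atTop, mdeg a k ≤ k := by
  filter_upwards [(tendsto_mdeg_div ha).eventually_lt_const (u := 1 / 4) (by norm_num),
    eventually_ge_atTop 1] with k hk hk1
  have hk1' : (1 : ℝ) ≤ k := by exact_mod_cast hk1
  rw [div_lt_iff₀ (by positivity)] at hk
  have : (mdeg a k : ℝ) ≤ k := by linarith
  exact_mod_cast this

end Auxiliary

/-- For the uniform random simple graph `G(n,d)` with `d = (m, m, 1, …, 1)`,
`m = ⌊√(a n)⌋`, `a > 0`, `n` even, the probability that `G(n,d)` contains the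
edge joining the two high-degree vertices converges to `a/(1+a)`. -/
theorem prob_edge_between_hubs (a : ℝ) (ha : 0 < a) :
    Tendsto (fun k : ℕ =>
        (Nat.card {G : SimpleGraph (Fin (2 * k + 2)) //
            DegCond a k G ∧ G.Adj ⟨0, by omega⟩ ⟨1, by omega⟩} : ℝ) /
        (Nat.card {G : SimpleGraph (Fin (2 * k + 2)) // DegCond a k G} : ℝ))
      atTop (nhds (a / (1 + a))) := by
  have hlim : Tendsto (fun k : ℕ => ((mdeg a k : ℝ) ^ 2 / (2 * k + 2)) /
      ((mdeg a k : ℝ) ^ 2 / (2 * k + 2) + (1 - 2 * ((mdeg a k : ℝ) / (2 * k + 2)))))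
      atTop (nhds (a / (a + (1 - 2 * 0)))) :=
    (tendsto_mdeg_sq_div ha).div ((tendsto_mdeg_sq_div ha).add
      (((tendsto_mdeg_div ha).const_mul 2).const_sub 1)) (by linarith)
  rw [mul_zero, sub_zero, add_comm a 1] at hlim
  refine hlim.congr' ?_
  filter_upwards [eventually_mdeg_le ha] with k hk
  rw [edge_prob_eq hk]
  have hn : (2 * k + 2 : ℝ) ≠ 0 := by positivity
  rw [← mul_div_mul_right _ _ hn]
  congr 1
  · field_simp
  · field_simp
end

section
/- Assume (1/n)Σ d_i → μ > 0, (1/n)Σ d_i² → μ₂ < ∞, and max_i d_i = o(n^{1/2}). Let ν = μ₂ - μ. Then in the configuration model multigraph, X_2/n → ν/2 in probability and X_3/n → ν²/(2μ) in probability, where X_k is the number of paths with k edges. -/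
open Finset Filter

abbrev HalfEdge (n : ℕ) (d : Fin n → ℕ) : Type := Σ i : Fin n, Fin (d i)

def IsConfig {n : ℕ} {d : Fin n → ℕ} (f : HalfEdge n d → HalfEdge n d) : Prop :=
  (∀ x, f (f x) = x) ∧ (∀ x, f x ≠ x)

instance {n : ℕ} {d : Fin n → ℕ} : DecidablePred (IsConfig (n := n) (d := d)) := fun f => by
  unfold IsConfig; infer_instance

/-- Probability, over a uniformly random configuration, of the event `P`. -/
noncomputable def probConf (n : ℕ) (d : Fin n → ℕ)
    (P : (HalfEdge n d → HalfEdge n d) → Prop) [DecidablePred P] : ℝ :=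
  (∑ f : HalfEdge n d → HalfEdge n d, if IsConfig f ∧ P f then (1 : ℝ) else 0) /
    (∑ f : HalfEdge n d → HalfEdge n d, if IsConfig f then (1 : ℝ) else 0)

/-- The number of paths with 2 edges of the configuration multigraph. -/
def numP2 {n : ℕ} {d : Fin n → ℕ} (f : HalfEdge n d → HalfEdge n d) : ℕ :=
  (Finset.univ.filter fun p : HalfEdge n d × HalfEdge n d =>
    p.1.1 = p.2.1 ∧ p.1 ≠ p.2 ∧
    (f p.1).1 ≠ p.1.1 ∧ (f p.2).1 ≠ p.1.1 ∧ (f p.1).1 ≠ (f p.2).1).card / 2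

/-- The number of paths with 3 edges of the configuration multigraph. -/
def numP3 {n : ℕ} {d : Fin n → ℕ} (f : HalfEdge n d → HalfEdge n d) : ℕ :=
  (Finset.univ.filter fun t : HalfEdge n d × HalfEdge n d × HalfEdge n d =>
    t.1.1 = t.2.1.1 ∧ t.1 ≠ t.2.1 ∧ (f t.2.1).1 = t.2.2.1 ∧ t.2.2 ≠ f t.2.1 ∧
    (f t.1).1 ≠ t.1.1 ∧ (f t.1).1 ≠ t.2.2.1 ∧ (f t.1).1 ≠ (f t.2.2).1 ∧
    t.1.1 ≠ t.2.2.1 ∧ t.1.1 ≠ (f t.2.2).1 ∧ t.2.2.1 ≠ (f t.2.2).1).card / 2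

section Configurations

variable {n : ℕ} {d : Fin n → ℕ}

/-- The finite set of configurations. -/
def configs (n : ℕ) (d : Fin n → ℕ) : Finset (HalfEdge n d → HalfEdge n d) :=
  Finset.univ.filter IsConfig

lemma mem_configs {f : HalfEdge n d → HalfEdge n d} : f ∈ configs n d ↔ IsConfig f := by
  simp [configs]

/-- Conjugation of a map on half-edges by a transposition. -/
def swapConj (y z : HalfEdge n d) (f : HalfEdge n d → HalfEdge n d) :
    HalfEdge n d → HalfEdge n d :=
  fun x => Equiv.swap y z (f (Equiv.swap y z x))

lemma swapConj_swapConj (y z : HalfEdge n d) (f : HalfEdge n d → HalfEdge n d) :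
    swapConj y z (swapConj y z f) = f := by
  funext x
  simp [swapConj]

lemma IsConfig.swapConj {f : HalfEdge n d → HalfEdge n d} (hf : IsConfig f)
    (y z : HalfEdge n d) : IsConfig (swapConj y z f) := by
  refine ⟨fun x => by simp [_root_.swapConj, hf.1], fun x h => ?_⟩
  apply hf.2 (Equiv.swap y z x)
  have := congrArg (Equiv.swap y z) h
  simpa [_root_.swapConj] using this

/-- A set `A` of configurations that determines the matching inside `S` only: its members
match `S` with itself, and `A` is invariant under exchanging half-edges outside `S`. -/
structure IsRevealed (A : Finset (HalfEdge n d → HalfEdge n d)) (S : Finset (HalfEdge n d)) :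
    Prop where
  isConfig : ∀ f ∈ A, IsConfig f
  maps : ∀ f ∈ A, ∀ s ∈ S, f s ∈ S
  swap_mem : ∀ f ∈ A, ∀ y ∉ S, ∀ z ∉ S, swapConj y z f ∈ A

lemma isRevealed_configs : IsRevealed (configs n d) ∅ where
  isConfig f hf := mem_configs.1 hf
  maps := by simp
  swap_mem f hf y _ z _ := mem_configs.2 ((mem_configs.1 hf).swapConj y z)

lemma IsRevealed.filter {A : Finset (HalfEdge n d → HalfEdge n d)} {S : Finset (HalfEdge n d)}
    (h : IsRevealed A S) (x y : HalfEdge n d) :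
    IsRevealed (A.filter fun f => f x = y) (insert x (insert y S)) where
  isConfig f hf := h.isConfig f (Finset.mem_filter.1 hf).1
  maps f hf s hs := by
    obtain ⟨hA, hxy⟩ := Finset.mem_filter.1 hf
    have hyx : f y = x := by rw [← hxy, (h.isConfig f hA).1]
    simp only [Finset.mem_insert] at hs ⊢
    rcases hs with rfl | rfl | hs
    · exact Or.inr (Or.inl hxy)
    · exact Or.inl hyx
    · exact Or.inr (Or.inr (h.maps f hA s hs))
  swap_mem f hf z hz z' hz' := by
    obtain ⟨hA, hxy⟩ := Finset.mem_filter.1 hf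
    simp only [Finset.mem_insert, not_or] at hz hz'
    refine Finset.mem_filter.2 ⟨h.swap_mem f hA z hz.2.2 z' hz'.2.2, ?_⟩
    unfold swapConj
    rw [Equiv.swap_apply_of_ne_of_ne (Ne.symm hz.1) (Ne.symm hz'.1), hxy,
      Equiv.swap_apply_of_ne_of_ne (Ne.symm hz.2.1) (Ne.symm hz'.2.1)]

/-- Given what is revealed on `S`, the partner of `x` is uniform outside `insert x S`. -/
lemma IsRevealed.card_filter_mul {A : Finset (HalfEdge n d → HalfEdge n d)}
    {S : Finset (HalfEdge n d)} (h : IsRevealed A S) {x y : HalfEdge n d}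
    (hx : x ∉ S) (hy : y ∉ S) (hxy : x ≠ y) :
    ((A.filter fun f => f x = y).card : ℝ) * (Fintype.card (HalfEdge n d) - (S.card + 1)) =
      A.card := by
  have hmaps : ∀ f ∈ A, f x ∈ (insert x S)ᶜ := by
    intro f hf
    simp only [Finset.mem_compl, Finset.mem_insert, not_or]
    refine ⟨(h.isConfig f hf).2 x, fun hS => hx ?_⟩
    have := h.maps f hf _ hS
    rwa [(h.isConfig f hf).1] at this
  have hfib : ∀ z ∈ (insert x S)ᶜ,
      (A.filter fun f => f x = z).card = (A.filter fun f => f x = y).card := by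
    intro z hz
    simp only [Finset.mem_compl, Finset.mem_insert, not_or] at hz
    refine Finset.card_bij' (fun f _ => swapConj z y f) (fun f _ => swapConj z y f) ?_ ?_
      (fun f _ => swapConj_swapConj z y f) (fun f _ => swapConj_swapConj z y f)
    · intro f hf
      obtain ⟨hA, hfx⟩ := Finset.mem_filter.1 hf
      refine Finset.mem_filter.2 ⟨h.swap_mem f hA z hz.2 y hy, ?_⟩
      unfold swapConj
      rw [Equiv.swap_apply_of_ne_of_ne (Ne.symm hz.1) hxy, hfx, Equiv.swap_apply_left]
    · intro f hf
      obtain ⟨hA, hfx⟩ := Finset.mem_filter.1 hf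
      refine Finset.mem_filter.2 ⟨h.swap_mem f hA z hz.2 y hy, ?_⟩
      unfold swapConj
      rw [Equiv.swap_apply_of_ne_of_ne (Ne.symm hz.1) hxy, hfx, Equiv.swap_apply_right]
  have hsum := Finset.card_eq_sum_card_fiberwise hmaps
  rw [Finset.sum_congr rfl hfib, Finset.sum_const, smul_eq_mul, mul_comm] at hsum
  have hc := Finset.card_add_card_compl (insert x S)
  rw [Finset.card_insert_of_notMem hx] at hc
  rw [hsum, ← hc]
  push_cast
  ring

lemma card_filter_one {x y : HalfEdge n d} (hxy : x ≠ y) :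
    (((configs n d).filter fun f => f x = y).card : ℝ) * (Fintype.card (HalfEdge n d) - 1) =
      (configs n d).card := by
  have := isRevealed_configs.card_filter_mul (d := d) (x := x) (y := y) (by simp) (by simp) hxy
  simpa using this

lemma card_filter_two {x y x' y' : HalfEdge n d} (hxy : x ≠ y) (hxx : x' ≠ x) (hxy' : x' ≠ y)
    (hyx : y' ≠ x) (hyy : y' ≠ y) (hxy'' : x' ≠ y') :
    (((configs n d).filter fun f => f x = y ∧ f x' = y').card : ℝ) *
      ((Fintype.card (HalfEdge n d) - 1) * (Fintype.card (HalfEdge n d) - 3)) =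
      (configs n d).card := by
  have h := (isRevealed_configs.filter (d := d) x y).card_filter_mul (x := x') (y := y')
    (by simp [hxx, hxy']) (by simp [hyx, hyy]) hxy''
  rw [Finset.card_insert_of_notMem (by simpa using hxy), Finset.card_insert_of_notMem (by simp),
    Finset.card_empty, Finset.filter_filter] at h
  rw [← card_filter_one hxy, ← h]
  push_cast
  ring

lemma card_filter_three {x y x' y' x'' y'' : HalfEdge n d}
    (hnd : [x, y, x', y', x'', y''].Nodup) :
    (((configs n d).filter fun f => f x = y ∧ f x' = y' ∧ f x'' = y'').card : ℝ) *
      ((Fintype.card (HalfEdge n d) - 1) * (Fintype.card (HalfEdge n d) - 3) *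
        (Fintype.card (HalfEdge n d) - 5)) =
      (configs n d).card := by
  simp only [List.nodup_cons, List.mem_cons, List.not_mem_nil, or_false, not_or] at hnd
  obtain ⟨⟨h1, h2, h3, h4, h5⟩, ⟨h6, h7, h8, h9⟩, ⟨h10, h11, h12⟩, ⟨h13, h14⟩, h15, -⟩ := hnd
  have h := ((isRevealed_configs.filter (d := d) x y).filter x' y').card_filter_mul
    (x := x'') (y := y'')
    (by simp [Ne.symm h4, Ne.symm h8, Ne.symm h11, Ne.symm h13])
    (by simp [Ne.symm h5, Ne.symm h9, Ne.symm h12, Ne.symm h14]) h15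
  rw [Finset.card_insert_of_notMem (by simp [h10, Ne.symm h2, Ne.symm h6]),
    Finset.card_insert_of_notMem (by simp [Ne.symm h3, Ne.symm h7]),
    Finset.card_insert_of_notMem (by simpa using h1), Finset.card_insert_of_notMem (by simp),
    Finset.card_empty] at h
  simp only [Finset.filter_filter, and_assoc] at h
  rw [← card_filter_two (x := x) (y := y) (x' := x') (y' := y') h1 (Ne.symm h2) (Ne.symm h6)
    (Ne.symm h3) (Ne.symm h7) h10, ← h]
  push_cast
  ring

/-- Indicator of two half-edges lying at the same vertex. -/
def same (x y : HalfEdge n d) : ℝ := if x.1 = y.1 then 1 else 0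

/-- Indicator of two half-edges being distinct. -/
def distinct (x y : HalfEdge n d) : ℝ := if x = y then 0 else 1

lemma same_comm (x y : HalfEdge n d) : same x y = same y x := by
  simp [same, eq_comm]

lemma same_nonneg (x y : HalfEdge n d) : 0 ≤ same x y := by
  unfold same; split_ifs <;> norm_num

lemma same_le_one (x y : HalfEdge n d) : same x y ≤ 1 := by
  unfold same; split_ifs <;> norm_num

lemma distinct_nonneg (x y : HalfEdge n d) : 0 ≤ distinct x y := by
  unfold distinct; split_ifs <;> norm_num

lemma distinct_le_one (x y : HalfEdge n d) : distinct x y ≤ 1 := by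
  unfold distinct; split_ifs <;> norm_num

lemma sum_halfEdge (F : Fin n → ℝ) : ∑ x : HalfEdge n d, F x.1 = ∑ i, (d i : ℝ) * F i := by
  simp [Fintype.sum_sigma]

lemma sum_same (x : HalfEdge n d) : ∑ y, same x y = d x.1 := by
  unfold same
  rw [sum_halfEdge (d := d) (fun i => if x.1 = i then (1 : ℝ) else 0)]
  simp

lemma sum_same' (x : HalfEdge n d) : ∑ y, same y x = d x.1 := by
  simp_rw [same_comm _ x, sum_same]

lemma sum_same_mul_distinct (x : HalfEdge n d) :
    ∑ y, same x y * distinct x y = (d x.1 : ℝ) - 1 := by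
  have h : ∀ y : HalfEdge n d, same x y * distinct x y = same x y - if x = y then 1 else 0 := by
    intro y
    unfold distinct
    split_ifs with h
    · simp [h, same]
    · simp
  simp_rw [h, Finset.sum_sub_distrib, sum_same]
  simp

lemma sum_sum_same : ∑ x : HalfEdge n d, ∑ y, same x y = ∑ i, (d i : ℝ) ^ 2 := by
  simp_rw [sum_same]
  rw [sum_halfEdge (d := d) (fun i => (d i : ℝ))]
  simp_rw [sq]

lemma sum_configs_comp {κ : Type*} [Fintype κ] [DecidableEq κ]
    (φ : (HalfEdge n d → HalfEdge n d) → κ) (G : κ → ℝ) :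
    ∑ f ∈ configs n d, G (φ f) = ∑ q, (((configs n d).filter fun f => φ f = q).card : ℝ) * G q := by
  rw [← Finset.sum_fiberwise (configs n d) φ]
  refine Finset.sum_congr rfl fun q _ => ?_
  rw [Finset.sum_congr rfl (g := fun _ => G q) fun f hf => by rw [(Finset.mem_filter.1 hf).2]]
  simp

lemma card_filter_one_eq (hN : (1 : ℝ) < Fintype.card (HalfEdge n d)) (x y : HalfEdge n d) :
    (((configs n d).filter fun f => f x = y).card : ℝ) =
      (configs n d).card / (Fintype.card (HalfEdge n d) - 1) * distinct x y := by
  by_cases h : x = y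
  · subst h
    simp only [distinct, if_true, mul_zero, Nat.cast_eq_zero, Finset.card_eq_zero]
    exact Finset.filter_eq_empty_iff.2 fun f hf => (mem_configs.1 hf).2 x
  · have := card_filter_one h
    rw [distinct, if_neg h, mul_one, eq_div_iff (by linarith)]
    exact this

lemma card_filter_two_le (hN : (3 : ℝ) < Fintype.card (HalfEdge n d)) (x x' y y' : HalfEdge n d) :
    (((configs n d).filter fun f => f x = y ∧ f x' = y').card : ℝ) ≤
      (configs n d).card /
          ((Fintype.card (HalfEdge n d) - 1) * (Fintype.card (HalfEdge n d) - 3)) +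
        (configs n d).card / (Fintype.card (HalfEdge n d) - 1) *
          (if x = x' ∧ y = y' then 1 else 0) +
        (configs n d).card / (Fintype.card (HalfEdge n d) - 1) *
          (if x = y' ∧ y = x' then 1 else 0) := by
  have hN1 : (0 : ℝ) < Fintype.card (HalfEdge n d) - 1 := by linarith
  have hN3 : (0 : ℝ) < Fintype.card (HalfEdge n d) - 3 := by linarith
  have hA : (0 : ℝ) ≤ (configs n d).card /
      ((Fintype.card (HalfEdge n d) - 1) * (Fintype.card (HalfEdge n d) - 3)) := by positivity
  have hB : (0 : ℝ) ≤ (configs n d).card / (Fintype.card (HalfEdge n d) - 1) := by positivity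
  have hle : (((configs n d).filter fun f => f x = y ∧ f x' = y').card : ℝ) ≤
      (configs n d).card / (Fintype.card (HalfEdge n d) - 1) := by
    have h1 := card_filter_one_eq (by linarith) x y
    have h2 : ((configs n d).filter fun f => f x = y ∧ f x' = y').card ≤
        ((configs n d).filter fun f => f x = y).card :=
      Finset.card_le_card fun f hf => by
        simp only [Finset.mem_filter] at hf ⊢
        exact ⟨hf.1, hf.2.1⟩
    have h3 := mul_le_mul_of_nonneg_left (distinct_le_one x y) hB
    rw [← h1, mul_one] at h3
    exact (Nat.cast_le.2 h2).trans h3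
  by_cases h1 : x = x' ∧ y = y'
  · rw [if_pos h1]
    split_ifs <;> linarith
  rw [if_neg h1]
  by_cases h2 : x = y' ∧ y = x'
  · rw [if_pos h2]
    linarith
  rw [if_neg h2]
  by_cases hnd : x ≠ y ∧ x' ≠ x ∧ x' ≠ y ∧ y' ≠ x ∧ y' ≠ y ∧ x' ≠ y'
  · obtain ⟨a1, a2, a3, a4, a5, a6⟩ := hnd
    have := card_filter_two a1 a2 a3 a4 a5 a6
    rw [← eq_div_iff (by positivity)] at this
    linarith
  · have : ((configs n d).filter fun f => f x = y ∧ f x' = y') = ∅ := by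
      refine Finset.filter_eq_empty_iff.2 fun f hf ⟨hfx, hfx'⟩ => hnd ?_
      obtain ⟨hi, hfp⟩ := mem_configs.1 hf
      have hfy : f y = x := by rw [← hfx, hi]
      have hfy' : f y' = x' := by rw [← hfx', hi]
      refine ⟨fun h => hfp x (h ▸ hfx), ?_, ?_, ?_, ?_, fun h => hfp x' (h ▸ hfx')⟩
      · rintro rfl
        exact h1 ⟨rfl, hfx.symm.trans hfx'⟩
      · rintro rfl
        exact h2 ⟨hfy.symm.trans hfx', rfl⟩
      · rintro rfl
        exact h2 ⟨rfl, hfx.symm.trans hfy'⟩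
      · rintro rfl
        exact h1 ⟨hfy.symm.trans hfy', rfl⟩
    rw [this]
    simpa using hA

/-- First moment of a sum over the edges of a random configuration. -/
lemma sum_configs_one (hN : (1 : ℝ) < Fintype.card (HalfEdge n d))
    (g : HalfEdge n d → HalfEdge n d → ℝ) :
    ∑ f ∈ configs n d, ∑ x, g x (f x) =
      (configs n d).card / (Fintype.card (HalfEdge n d) - 1) *
        ∑ x, ∑ y, distinct x y * g x y := by
  rw [Finset.sum_comm, Finset.mul_sum]
  refine Finset.sum_congr rfl fun x _ => ?_
  rw [sum_configs_comp (fun f => f x) (g x), Finset.mul_sum]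
  refine Finset.sum_congr rfl fun y _ => ?_
  rw [card_filter_one_eq hN, mul_assoc]

/-- First moment bound for a sum over pairs of edges of a random configuration. -/
lemma sum_configs_two_le (hN : (3 : ℝ) < Fintype.card (HalfEdge n d))
    (g : HalfEdge n d → HalfEdge n d → HalfEdge n d → HalfEdge n d → ℝ)
    (hg : ∀ x x' y y', 0 ≤ g x x' y y') :
    ∑ f ∈ configs n d, ∑ x, ∑ x', g x x' (f x) (f x') ≤
      (configs n d).card /
          ((Fintype.card (HalfEdge n d) - 1) * (Fintype.card (HalfEdge n d) - 3)) *
          ∑ x, ∑ x', ∑ y, ∑ y', g x x' y y' +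
        (configs n d).card / (Fintype.card (HalfEdge n d) - 1) * ∑ x, ∑ y, g x x y y +
        (configs n d).card / (Fintype.card (HalfEdge n d) - 1) * ∑ x, ∑ y, g x y y x := by
  set A : ℝ := (configs n d).card /
    ((Fintype.card (HalfEdge n d) - 1) * (Fintype.card (HalfEdge n d) - 3)) with hA
  set B : ℝ := (configs n d).card / (Fintype.card (HalfEdge n d) - 1) with hB
  have key : ∀ x x', ∑ f ∈ configs n d, g x x' (f x) (f x') ≤
      A * ∑ y, ∑ y', g x x' y y' + B * (if x = x' then ∑ y, g x x y y else 0) +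
        B * g x x' x' x := by
    intro x x'
    rw [sum_configs_comp (fun f => (f x, f x')) (fun q => g x x' q.1 q.2),
      Fintype.sum_prod_type]
    have : ∀ y y', (((configs n d).filter fun f => (f x, f x') = (y, y')).card : ℝ) *
        g x x' y y' ≤ A * g x x' y y' +
          B * (if x = x' then (if y = y' then g x x y y else 0) else 0) +
          B * (if y = x' then (if y' = x then g x x' x' x else 0) else 0) := by
      intro y y'
      have h := mul_le_mul_of_nonneg_right (card_filter_two_le hN x x' y y') (hg x x' y y')
      simp only [Prod.mk.injEq]
      refine h.trans (le_of_eq ?_)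
      rw [add_mul, add_mul, mul_assoc B, mul_assoc B]
      congr 1
      · congr 2
        by_cases h1 : x = x'
        · by_cases h2 : y = y'
          · subst h1 h2; simp
          · simp [h2]
        · simp [h1]
      · congr 1
        by_cases h1 : y = x'
        · by_cases h2 : y' = x
          · subst h1 h2; simp
          · simp [h2, Ne.symm h2]
        · simp [h1]
    refine (Finset.sum_le_sum fun y _ => Finset.sum_le_sum fun y' _ => this y y').trans
      (le_of_eq ?_)
    simp only [Finset.sum_add_distrib, ← Finset.mul_sum]
    congr 1
    · congr 2
      split_ifs <;> simp
    · simp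
  rw [Finset.sum_comm]
  simp_rw [Finset.sum_comm (s := configs n d)]
  refine (Finset.sum_le_sum fun x _ => Finset.sum_le_sum fun x' _ => key x x').trans
    (le_of_eq ?_)
  simp only [Finset.sum_add_distrib, ← Finset.mul_sum]
  simp

/-- The number of half-edges that belong to a loop. -/
def loops (f : HalfEdge n d → HalfEdge n d) : ℝ := ∑ a, same a (f a)

/-- The number of pairs of distinct half-edges at a common vertex whose partners also lie at a
common vertex. -/
def doubles (f : HalfEdge n d → HalfEdge n d) : ℝ :=
  ∑ a, ∑ b, same a b * distinct a b * same (f a) (f b)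

/-- The contribution of three half-edges to the number of triangles. -/
def triangleTerm (f : HalfEdge n d → HalfEdge n d) (a b c : HalfEdge n d) : ℝ :=
  if [a, f a, b, f b, c, f c].Nodup then same a b * same (f b) c * same (f a) (f c) else 0

/-- The number of rooted oriented triangles. -/
def triangles (f : HalfEdge n d → HalfEdge n d) : ℝ := ∑ a, ∑ b, ∑ c, triangleTerm f a b c

/-- The number of rooted oriented walks of length 3 that do not backtrack. -/
def walks (f : HalfEdge n d → HalfEdge n d) : ℝ :=
  ∑ b, ((d b.1 : ℝ) - 1) * ((d (f b).1 : ℝ) - 1)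

lemma triangleTerm_nonneg (f : HalfEdge n d → HalfEdge n d) (a b c : HalfEdge n d) :
    0 ≤ triangleTerm f a b c := by
  have := same_nonneg a b
  have := same_nonneg (f b) c
  have := same_nonneg (f a) (f c)
  unfold triangleTerm
  split_ifs <;> positivity

lemma degree_sub_one_nonneg (x : HalfEdge n d) : 0 ≤ (d x.1 : ℝ) - 1 := by
  have : 1 ≤ d x.1 := Nat.one_le_of_lt x.2.2
  have : (1 : ℝ) ≤ d x.1 := by exact_mod_cast this
  linarith

lemma IsConfig.sum_comp {f : HalfEdge n d → HalfEdge n d} (hf : IsConfig f)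
    (F : HalfEdge n d → ℝ) : ∑ x, F (f x) = ∑ x, F x :=
  Equiv.sum_comp (Function.Involutive.toPerm f hf.1) F

lemma sum_loops_le (hN : (1 : ℝ) < Fintype.card (HalfEdge n d)) :
    ∑ f ∈ configs n d, loops f ≤
      (configs n d).card / (Fintype.card (HalfEdge n d) - 1) * ∑ i, (d i : ℝ) ^ 2 := by
  unfold loops
  rw [sum_configs_one hN fun x y => same x y, ← sum_sum_same]
  have : (0 : ℝ) ≤ (configs n d).card / (Fintype.card (HalfEdge n d) - 1) :=
    div_nonneg (Nat.cast_nonneg _) (by linarith)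
  refine mul_le_mul_of_nonneg_left (Finset.sum_le_sum fun x _ => Finset.sum_le_sum fun y _ => ?_)
    this
  exact mul_le_of_le_one_left (same_nonneg x y) (distinct_le_one x y)

lemma sum_doubles_le (hN : (3 : ℝ) < Fintype.card (HalfEdge n d)) :
    ∑ f ∈ configs n d, doubles f ≤
      (configs n d).card /
          ((Fintype.card (HalfEdge n d) - 1) * (Fintype.card (HalfEdge n d) - 3)) *
          (∑ i, (d i : ℝ) ^ 2) ^ 2 +
        (configs n d).card / (Fintype.card (HalfEdge n d) - 1) * ∑ i, (d i : ℝ) ^ 2 := by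
  have hB : (0 : ℝ) ≤ (configs n d).card / (Fintype.card (HalfEdge n d) - 1) :=
    div_nonneg (Nat.cast_nonneg _) (by linarith)
  have hA : (0 : ℝ) ≤ (configs n d).card /
      ((Fintype.card (HalfEdge n d) - 1) * (Fintype.card (HalfEdge n d) - 3)) :=
    div_nonneg (Nat.cast_nonneg _) (mul_nonneg (by linarith) (by linarith))
  have hle : ∀ x y : HalfEdge n d, same x y * distinct x y ≤ same x y := fun x y =>
    mul_le_of_le_one_right (same_nonneg x y) (distinct_le_one x y)
  unfold doubles
  refine (sum_configs_two_le hN (fun a b y y' => same a b * distinct a b * same y y')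
    fun x x' y y' => mul_nonneg (mul_nonneg (same_nonneg _ _) (distinct_nonneg _ _))
      (same_nonneg _ _)).trans ?_
  have h1 : ∑ x : HalfEdge n d, ∑ x', ∑ y : HalfEdge n d, ∑ y',
      same x x' * distinct x x' * same y y' ≤ (∑ i, (d i : ℝ) ^ 2) ^ 2 := by
    simp_rw [← Finset.mul_sum, sum_sum_same, ← Finset.sum_mul]
    rw [sq]
    refine mul_le_mul_of_nonneg_right ?_ (by positivity)
    rw [← sum_sum_same]
    exact Finset.sum_le_sum fun x _ => Finset.sum_le_sum fun y _ => hle x y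
  have h2 : ∑ x : HalfEdge n d, ∑ y : HalfEdge n d, same x x * distinct x x * same y y = 0 := by
    simp [distinct]
  have h3 : ∑ x : HalfEdge n d, ∑ y, same x y * distinct x y * same y x ≤
      ∑ i, (d i : ℝ) ^ 2 := by
    rw [← sum_sum_same]
    refine Finset.sum_le_sum fun x _ => Finset.sum_le_sum fun y _ => ?_
    exact (mul_le_of_le_one_right (mul_nonneg (same_nonneg x y) (distinct_nonneg x y))
      (same_le_one y x)).trans (hle x y)
  rw [h2, mul_zero, add_zero]
  exact add_le_add (mul_le_mul_of_nonneg_left h1 hA) (mul_le_mul_of_nonneg_left h3 hB)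

lemma sum_triangles_le (hN : (5 : ℝ) < Fintype.card (HalfEdge n d)) :
    ∑ f ∈ configs n d, triangles f ≤
      (configs n d).card /
          ((Fintype.card (HalfEdge n d) - 1) * (Fintype.card (HalfEdge n d) - 3) *
            (Fintype.card (HalfEdge n d) - 5)) *
          (∑ i, (d i : ℝ) ^ 2) ^ 3 := by
  have hN1 : (0 : ℝ) < Fintype.card (HalfEdge n d) - 1 := by linarith
  have hN3 : (0 : ℝ) < Fintype.card (HalfEdge n d) - 3 := by linarith
  have hN5 : (0 : ℝ) < Fintype.card (HalfEdge n d) - 5 := by linarith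
  set A : ℝ := (configs n d).card /
    ((Fintype.card (HalfEdge n d) - 1) * (Fintype.card (HalfEdge n d) - 3) *
      (Fintype.card (HalfEdge n d) - 5)) with hA
  have hA0 : 0 ≤ A := by positivity
  have key : ∀ a b c, ∑ f ∈ configs n d, triangleTerm f a b c ≤
      ∑ a' : HalfEdge n d, ∑ b', ∑ c', A * (same a b * same b' c * same a' c') := by
    intro a b c
    unfold triangleTerm
    rw [sum_configs_comp (fun f => (f a, f b, f c)) (fun q =>
      if [a, q.1, b, q.2.1, c, q.2.2].Nodup then same a b * same q.2.1 c * same q.1 q.2.2 else 0),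
      Fintype.sum_prod_type]
    refine Finset.sum_le_sum fun a' _ => ?_
    rw [Fintype.sum_prod_type]
    refine Finset.sum_le_sum fun b' _ => Finset.sum_le_sum fun c' _ => ?_
    have h0 : 0 ≤ same a b * same b' c * same a' c' :=
      mul_nonneg (mul_nonneg (same_nonneg _ _) (same_nonneg _ _)) (same_nonneg _ _)
    by_cases hnd : [a, a', b, b', c, c'].Nodup
    · rw [if_pos hnd]
      have := card_filter_three hnd
      rw [← eq_div_iff (by positivity)] at this
      simp only [Prod.mk.injEq]
      rw [this]
    · rw [if_neg hnd, mul_zero]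
      exact mul_nonneg hA0 h0
  unfold triangles
  rw [Finset.sum_comm]
  simp_rw [Finset.sum_comm (s := configs n d)]
  refine (Finset.sum_le_sum fun a _ => Finset.sum_le_sum fun b _ =>
    Finset.sum_le_sum fun c _ => key a b c).trans (le_of_eq ?_)
  have hS := sum_sum_same (n := n) (d := d)
  have hS' : ∑ x : HalfEdge n d, ∑ y, same y x = ∑ i, (d i : ℝ) ^ 2 := by
    rw [Finset.sum_comm, hS]
  have : ∀ a b c : HalfEdge n d, ∑ a' : HalfEdge n d, ∑ b', ∑ c' : HalfEdge n d,
      A * (same a b * same b' c * same a' c') =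
      A * same a b * (∑ i, (d i : ℝ) ^ 2) * ∑ b', same b' c := by
    intro a b c
    rw [Finset.sum_comm]
    simp_rw [← Finset.mul_sum, hS, ← Finset.sum_mul, ← Finset.mul_sum]
    ring
  simp_rw [this, ← Finset.mul_sum, hS', ← Finset.sum_mul, ← Finset.mul_sum, hS]
  ring

/-- Second moment of the centred number of non-backtracking walks. -/
lemma sum_sq_walks_sub_le (hN : (3 : ℝ) < Fintype.card (HalfEdge n d)) (W Q : ℝ)
    (hW : ∑ x : HalfEdge n d, ((d x.1 : ℝ) - 1) = W)
    (hQ : ∑ x : HalfEdge n d, ((d x.1 : ℝ) - 1) ^ 2 = Q) :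
    ∑ f ∈ configs n d, (walks f - W ^ 2 / (Fintype.card (HalfEdge n d) - 1)) ^ 2 ≤
      (configs n d).card *
        (W ^ 4 / ((Fintype.card (HalfEdge n d) - 1) * (Fintype.card (HalfEdge n d) - 3)) -
          W ^ 4 / (Fintype.card (HalfEdge n d) - 1) ^ 2 +
          2 * Q ^ 2 / (Fintype.card (HalfEdge n d) - 1) +
          2 * W ^ 2 * Q / (Fintype.card (HalfEdge n d) - 1) ^ 2) := by
  have hN1 : (0 : ℝ) < Fintype.card (HalfEdge n d) - 1 := by linarith
  have hN3 : (0 : ℝ) < Fintype.card (HalfEdge n d) - 3 := by linarith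
  have hT : ∑ f ∈ configs n d, walks f =
      (configs n d).card / (Fintype.card (HalfEdge n d) - 1) * (W ^ 2 - Q) := by
    unfold walks
    rw [sum_configs_one (by linarith) fun x y : HalfEdge n d =>
      ((d x.1 : ℝ) - 1) * ((d y.1 : ℝ) - 1)]
    congr 1
    have : ∀ x y : HalfEdge n d, distinct x y * (((d x.1 : ℝ) - 1) * ((d y.1 : ℝ) - 1)) =
        ((d x.1 : ℝ) - 1) * ((d y.1 : ℝ) - 1) -
          if x = y then ((d x.1 : ℝ) - 1) ^ 2 else 0 := by
      intro x y
      unfold distinct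
      split_ifs with h
      · subst h; ring
      · ring
    simp_rw [this, Finset.sum_sub_distrib, ← Finset.mul_sum, hW, ← Finset.sum_mul, hW]
    simp [← hQ, sq]
  have hT2 : ∑ f ∈ configs n d, walks f ^ 2 ≤
      (configs n d).card /
          ((Fintype.card (HalfEdge n d) - 1) * (Fintype.card (HalfEdge n d) - 3)) * W ^ 4 +
        (configs n d).card / (Fintype.card (HalfEdge n d) - 1) * Q ^ 2 +
        (configs n d).card / (Fintype.card (HalfEdge n d) - 1) * Q ^ 2 := by
    have h := sum_configs_two_le hN (fun x x' y y' : HalfEdge n d =>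
      (((d x.1 : ℝ) - 1) * ((d y.1 : ℝ) - 1)) * (((d x'.1 : ℝ) - 1) * ((d y'.1 : ℝ) - 1)))
      fun x x' y y' => mul_nonneg
        (mul_nonneg (degree_sub_one_nonneg _) (degree_sub_one_nonneg _))
        (mul_nonneg (degree_sub_one_nonneg _) (degree_sub_one_nonneg _))
    have e1 : ∑ x : HalfEdge n d, ∑ x' : HalfEdge n d, ∑ y : HalfEdge n d, ∑ y' : HalfEdge n d,
        (((d x.1 : ℝ) - 1) * ((d y.1 : ℝ) - 1)) * (((d x'.1 : ℝ) - 1) * ((d y'.1 : ℝ) - 1)) =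
        W ^ 4 := by
      simp only [← Finset.mul_sum, ← Finset.sum_mul, hW]
      ring
    have e2 : ∑ x : HalfEdge n d, ∑ y : HalfEdge n d,
        (((d x.1 : ℝ) - 1) * ((d y.1 : ℝ) - 1)) * (((d x.1 : ℝ) - 1) * ((d y.1 : ℝ) - 1)) =
        Q ^ 2 := by
      rw [← hQ, sq, Finset.sum_mul_sum]
      exact Finset.sum_congr rfl fun x _ => Finset.sum_congr rfl fun y _ => by ring
    have e3 : ∑ x : HalfEdge n d, ∑ y : HalfEdge n d,
        (((d x.1 : ℝ) - 1) * ((d y.1 : ℝ) - 1)) * (((d y.1 : ℝ) - 1) * ((d x.1 : ℝ) - 1)) =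
        Q ^ 2 := by
      rw [← e2]
      exact Finset.sum_congr rfl fun x _ => Finset.sum_congr rfl fun y _ => by ring
    rw [e1, e2, e3] at h
    refine le_trans (le_of_eq (Finset.sum_congr rfl fun f _ => ?_)) h
    rw [walks, sq, Finset.sum_mul_sum]
  set c := W ^ 2 / ((Fintype.card (HalfEdge n d) : ℝ) - 1) with hc
  have hexp : ∑ f ∈ configs n d, (walks f - c) ^ 2 =
      ∑ f ∈ configs n d, walks f ^ 2 - 2 * c * ∑ f ∈ configs n d, walks f +
        (configs n d).card * c ^ 2 := by
    rw [Finset.mul_sum, ← Finset.sum_sub_distrib, ← nsmul_eq_mul, ← Finset.sum_const,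
      ← Finset.sum_add_distrib]
    exact Finset.sum_congr rfl fun f _ => by ring
  rw [hexp, hT]
  refine (add_le_add_left (sub_le_sub_right hT2 _) _).trans (le_of_eq ?_)
  rw [hc]
  field_simp
  ring

lemma same_eq_one {x y : HalfEdge n d} (h : x.1 = y.1) : same x y = 1 := if_pos h

lemma same_eq_zero {x y : HalfEdge n d} (h : x.1 ≠ y.1) : same x y = 0 := if_neg h

lemma distinct_eq_one {x y : HalfEdge n d} (h : x ≠ y) : distinct x y = 1 := if_neg h

lemma distinct_eq_zero {x y : HalfEdge n d} (h : x = y) : distinct x y = 0 := if_pos h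

/-- The condition under which two half-edges span a path with 2 edges. -/
abbrev IsPathTwo (f : HalfEdge n d → HalfEdge n d) (a b : HalfEdge n d) : Prop :=
  a.1 = b.1 ∧ a ≠ b ∧ (f a).1 ≠ a.1 ∧ (f b).1 ≠ a.1 ∧ (f a).1 ≠ (f b).1

/-- The condition under which three half-edges span a path with 3 edges. -/
abbrev IsPathThree (f : HalfEdge n d → HalfEdge n d) (a b c : HalfEdge n d) : Prop :=
  a.1 = b.1 ∧ a ≠ b ∧ (f b).1 = c.1 ∧ c ≠ f b ∧
    (f a).1 ≠ a.1 ∧ (f a).1 ≠ c.1 ∧ (f a).1 ≠ (f c).1 ∧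
    a.1 ≠ c.1 ∧ a.1 ≠ (f c).1 ∧ c.1 ≠ (f c).1

lemma isPathTwo_indicator_le (f : HalfEdge n d → HalfEdge n d) (a b : HalfEdge n d) :
    (if IsPathTwo f a b then (1 : ℝ) else 0) ≤ same a b * distinct a b := by
  split_ifs with h
  · rw [same_eq_one h.1, distinct_eq_one h.2.1, mul_one]
  · exact mul_nonneg (same_nonneg _ _) (distinct_nonneg _ _)

lemma le_isPathTwo_indicator_add (f : HalfEdge n d → HalfEdge n d) (a b : HalfEdge n d) :
    same a b * distinct a b ≤ (if IsPathTwo f a b then (1 : ℝ) else 0) +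
      (same a b * same a (f a) + same a b * same b (f b) +
        same a b * distinct a b * same (f a) (f b)) := by
  have n1 := same_nonneg a b
  have n2 := same_nonneg a (f a)
  have n3 := same_nonneg b (f b)
  have n4 := same_nonneg (f a) (f b)
  have n5 := distinct_nonneg a b
  have n6 : (0 : ℝ) ≤ if IsPathTwo f a b then (1 : ℝ) else 0 := by split_ifs <;> norm_num
  have m1 := mul_nonneg n1 n2
  have m2 := mul_nonneg n1 n3
  have m3 := mul_nonneg (mul_nonneg n1 n5) n4
  by_cases hab : a.1 = b.1
  swap
  · simpa [same_eq_zero hab] using n6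
  by_cases hne : a = b
  · simp only [distinct_eq_zero hne, mul_zero]
    linarith
  have e1 := same_eq_one hab
  have e2 := distinct_eq_one hne
  rw [e1, e2] at *
  by_cases h1 : (f a).1 = a.1
  · rw [same_eq_one h1.symm] at *
    linarith
  by_cases h2 : (f b).1 = a.1
  · rw [same_eq_one (hab.symm.trans h2.symm)] at *
    linarith
  by_cases h3 : (f a).1 = (f b).1
  · rw [same_eq_one h3] at *
    linarith
  rw [if_pos ⟨hab, hne, h1, h2, h3⟩]
  linarith

lemma isPathThree_indicator_le (f : HalfEdge n d → HalfEdge n d) (a b c : HalfEdge n d) :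
    (if IsPathThree f a b c then (1 : ℝ) else 0) ≤
      same b a * distinct b a * (same (f b) c * distinct (f b) c) := by
  split_ifs with h
  · rw [same_eq_one h.1.symm, distinct_eq_one h.2.1.symm, same_eq_one h.2.2.1,
      distinct_eq_one h.2.2.2.1.symm]
    norm_num
  · exact mul_nonneg (mul_nonneg (same_nonneg _ _) (distinct_nonneg _ _))
      (mul_nonneg (same_nonneg _ _) (distinct_nonneg _ _))

lemma le_isPathThree_indicator_add {f : HalfEdge n d → HalfEdge n d} (hf : IsConfig f)
    (a b c : HalfEdge n d) :
    same b a * distinct b a * (same (f b) c * distinct (f b) c) ≤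
      (if IsPathThree f a b c then (1 : ℝ) else 0) +
      (same a (f a) * (same a b * same (f b) c) +
        same a b * distinct a b * same (f a) (f b) * same (f b) c +
        triangleTerm f a b c +
        same b (f b) * (same b a * same (f b) c) +
        same (f b) c * distinct (f b) c * same b (f c) * same b a +
        same c (f c) * (same (f b) c * same b a)) := by
  have hsd : ∀ x y : HalfEdge n d, 0 ≤ same x y * distinct x y := fun x y =>
    mul_nonneg (same_nonneg _ _) (distinct_nonneg _ _)
  have p0 : (0 : ℝ) ≤ if IsPathThree f a b c then (1 : ℝ) else 0 := by split_ifs <;> norm_num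
  have p1 : 0 ≤ same a (f a) * (same a b * same (f b) c) :=
    mul_nonneg (same_nonneg _ _) (mul_nonneg (same_nonneg _ _) (same_nonneg _ _))
  have p2 : 0 ≤ same a b * distinct a b * same (f a) (f b) * same (f b) c :=
    mul_nonneg (mul_nonneg (hsd _ _) (same_nonneg _ _)) (same_nonneg _ _)
  have p3 := triangleTerm_nonneg f a b c
  have p4 : 0 ≤ same b (f b) * (same b a * same (f b) c) :=
    mul_nonneg (same_nonneg _ _) (mul_nonneg (same_nonneg _ _) (same_nonneg _ _))
  have p5 : 0 ≤ same (f b) c * distinct (f b) c * same b (f c) * same b a :=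
    mul_nonneg (mul_nonneg (hsd _ _) (same_nonneg _ _)) (same_nonneg _ _)
  have p6 : 0 ≤ same c (f c) * (same (f b) c * same b a) :=
    mul_nonneg (same_nonneg _ _) (mul_nonneg (same_nonneg _ _) (same_nonneg _ _))
  by_cases hab : a.1 = b.1
  swap
  · rw [mul_assoc, mul_eq_zero_of_left (same_eq_zero (Ne.symm hab))]
    linarith
  by_cases hne : a = b
  · rw [mul_eq_zero_of_left (mul_eq_zero_of_right _ (distinct_eq_zero (Eq.symm hne)))]
    linarith
  by_cases hbc : (f b).1 = c.1
  swap
  · rw [mul_eq_zero_of_right _ (mul_eq_zero_of_left (same_eq_zero hbc) _)]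
    linarith
  by_cases hnc : f b = c
  · rw [mul_eq_zero_of_right _ (mul_eq_zero_of_right _ (distinct_eq_zero hnc))]
    linarith
  have e1 := same_eq_one hab
  have e2 := distinct_eq_one hne
  have e3 := same_eq_one hbc
  have e4 := distinct_eq_one hnc
  have e5 := same_eq_one hab.symm
  have e6 := distinct_eq_one (Ne.symm hne)
  rw [e1, e2, e3] at p2
  rw [e3, e4, e5] at p5
  rw [e1, e3] at p1
  rw [e3, e5] at p4 p6
  rw [e1, e2, e3, e4, e5, e6]
  by_cases h1 : (f a).1 = a.1
  · rw [same_eq_one h1.symm] at *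
    linarith
  by_cases h2 : (f a).1 = c.1
  · rw [same_eq_one (h2.trans hbc.symm)] at *
    linarith
  by_cases h4 : a.1 = c.1
  · rw [same_eq_one (hab.symm.trans (h4.trans hbc.symm))] at *
    linarith
  by_cases h5 : a.1 = (f c).1
  · rw [same_eq_one (hab.symm.trans h5)] at *
    linarith
  by_cases h6 : c.1 = (f c).1
  · rw [same_eq_one h6] at *
    linarith
  by_cases h3 : (f a).1 = (f c).1
  · have hinj : Function.Injective f := Function.Involutive.injective hf.1
    have hac : a ≠ c := fun h => h4 (congrArg Sigma.fst h)
    have hnd : [a, f a, b, f b, c, f c].Nodup := by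
      simp only [List.nodup_cons, List.mem_cons, List.not_mem_nil, or_false, not_or,
        not_false_eq_true, List.nodup_nil, and_true]
      refine ⟨⟨(hf.2 a).symm, hne, ?_, hac, fun h => h5 (congrArg Sigma.fst h)⟩,
        ⟨?_, fun h => hne (hinj h), fun h => h2 (congrArg Sigma.fst h), fun h => hac (hinj h)⟩,
        ⟨(hf.2 b).symm, ?_, ?_⟩, ⟨hnc, ?_⟩, (hf.2 c).symm⟩
      · exact fun h => h4 ((congrArg Sigma.fst h).trans hbc)
      · exact fun h => h1 ((congrArg Sigma.fst h).trans hab.symm)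
      · exact fun h => h4 (hab.trans (congrArg Sigma.fst h))
      · exact fun h => h5 (hab.trans (congrArg Sigma.fst h))
      · exact fun h => h4 (hab.trans (congrArg Sigma.fst (hinj h)))
    have : triangleTerm f a b c = 1 := by
      rw [triangleTerm, if_pos hnd, e1, e3, same_eq_one h3]
      norm_num
    rw [this]
    linarith
  rw [if_pos ⟨hab, hne, hbc, Ne.symm hnc, h1, h2, h3, h4, h5, h6⟩]
  linarith

lemma abs_natDiv_two_sub_le (m : ℕ) : |((m / 2 : ℕ) : ℝ) - m / 2| ≤ 1 := by
  have h1 : 2 * (m / 2) ≤ m := Nat.mul_div_le m 2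
  have h2 : m ≤ 2 * (m / 2) + 1 := by omega
  have h1' : 2 * ((m / 2 : ℕ) : ℝ) ≤ m := by exact_mod_cast h1
  have h2' : (m : ℝ) ≤ 2 * ((m / 2 : ℕ) : ℝ) + 1 := by exact_mod_cast h2
  rw [abs_le]
  constructor <;> linarith

lemma abs_numP2_sub_le (f : HalfEdge n d → HalfEdge n d) {Δ : ℝ} (hΔ : ∀ i, (d i : ℝ) ≤ Δ) :
    |(numP2 f : ℝ) - (∑ x : HalfEdge n d, ((d x.1 : ℝ) - 1)) / 2| ≤
      1 + (2 * Δ * loops f + doubles f) / 2 := by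
  have hcard : ((Finset.univ.filter fun p : HalfEdge n d × HalfEdge n d =>
      IsPathTwo f p.1 p.2).card : ℝ) = ∑ a, ∑ b, if IsPathTwo f a b then (1 : ℝ) else 0 := by
    rw [Finset.card_filter, Nat.cast_sum, Fintype.sum_prod_type]
    simp
  have hW : ∑ x : HalfEdge n d, ((d x.1 : ℝ) - 1) = ∑ a : HalfEdge n d, ∑ b,
      same a b * distinct a b := by simp_rw [sum_same_mul_distinct]
  set m := (Finset.univ.filter fun p : HalfEdge n d × HalfEdge n d =>
      IsPathTwo f p.1 p.2).card with hm
  have hdiv := abs_natDiv_two_sub_le m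
  have hup : (m : ℝ) ≤ ∑ x : HalfEdge n d, ((d x.1 : ℝ) - 1) := by
    rw [hcard, hW]
    exact Finset.sum_le_sum fun a _ => Finset.sum_le_sum fun b _ => isPathTwo_indicator_le f a b
  have hL1 : ∑ a, ∑ b, same a b * same a (f a) ≤ Δ * loops f := by
    simp_rw [← Finset.sum_mul, sum_same, loops, Finset.mul_sum]
    exact Finset.sum_le_sum fun a _ => mul_le_mul_of_nonneg_right (hΔ _) (same_nonneg _ _)
  have hL2 : ∑ a, ∑ b, same a b * same b (f b) ≤ Δ * loops f := by
    rw [Finset.sum_comm]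
    simp_rw [← Finset.sum_mul, sum_same', loops, Finset.mul_sum]
    exact Finset.sum_le_sum fun a _ => mul_le_mul_of_nonneg_right (hΔ _) (same_nonneg _ _)
  have hlow : ∑ x : HalfEdge n d, ((d x.1 : ℝ) - 1) ≤ m + (2 * Δ * loops f + doubles f) := by
    rw [hcard, hW]
    refine (Finset.sum_le_sum fun a _ => Finset.sum_le_sum fun b _ =>
      le_isPathTwo_indicator_add f a b).trans ?_
    simp only [Finset.sum_add_distrib]
    unfold doubles
    linarith
  have hnum : (numP2 f : ℝ) = ((m / 2 : ℕ) : ℝ) := rfl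
  rw [hnum]
  rw [abs_le] at hdiv ⊢
  constructor <;> linarith [hdiv.1, hdiv.2]

lemma abs_numP3_sub_le {f : HalfEdge n d → HalfEdge n d} (hf : IsConfig f) {Δ : ℝ}
    (hΔ0 : 0 ≤ Δ) (hΔ : ∀ i, (d i : ℝ) ≤ Δ) :
    |(numP3 f : ℝ) - walks f / 2| ≤
      1 + (3 * Δ ^ 2 * loops f + 2 * Δ * doubles f + triangles f) / 2 := by
  have hcard : ((Finset.univ.filter fun t : HalfEdge n d × HalfEdge n d × HalfEdge n d =>
      IsPathThree f t.1 t.2.1 t.2.2).card : ℝ) =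
      ∑ a, ∑ b, ∑ c, if IsPathThree f a b c then (1 : ℝ) else 0 := by
    rw [Finset.card_filter, Nat.cast_sum, Fintype.sum_prod_type]
    refine Finset.sum_congr rfl fun a _ => ?_
    rw [Fintype.sum_prod_type]
    simp
  have hW : walks f = ∑ a : HalfEdge n d, ∑ b, ∑ c,
      same b a * distinct b a * (same (f b) c * distinct (f b) c) := by
    rw [Finset.sum_comm]
    simp_rw [← Finset.mul_sum, ← Finset.sum_mul, sum_same_mul_distinct]
    rfl
  set m := (Finset.univ.filter fun t : HalfEdge n d × HalfEdge n d × HalfEdge n d =>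
      IsPathThree f t.1 t.2.1 t.2.2).card with hm
  have hdiv := abs_natDiv_two_sub_le m
  have hup : (m : ℝ) ≤ walks f := by
    rw [hcard, hW]
    exact Finset.sum_le_sum fun a _ => Finset.sum_le_sum fun b _ => Finset.sum_le_sum fun c _ =>
      isPathThree_indicator_le f a b c
  have hloop : ∀ g : HalfEdge n d → ℝ, (∀ x, g x ≤ Δ ^ 2) →
      ∑ x, same x (f x) * g x ≤ Δ ^ 2 * loops f := by
    intro g hg
    rw [loops, Finset.mul_sum]
    refine Finset.sum_le_sum fun x _ => ?_
    rw [mul_comm]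
    exact mul_le_mul_of_nonneg_right (hg x) (same_nonneg _ _)
  have hbound : ∀ (F : HalfEdge n d → ℝ) (x : HalfEdge n d), (∀ y, F y = same x y) →
      ∀ g : HalfEdge n d → ℝ, (∀ y, g y ≤ Δ) → ∑ y, F y * g y ≤ Δ ^ 2 := by
    intro F x hF g hg
    calc ∑ y, F y * g y ≤ ∑ y, same x y * Δ := Finset.sum_le_sum fun y _ => by
          rw [hF]; exact mul_le_mul_of_nonneg_left (hg y) (same_nonneg _ _)
      _ = d x.1 * Δ := by rw [← Finset.sum_mul, sum_same]
      _ ≤ Δ ^ 2 := by rw [sq]; exact mul_le_mul_of_nonneg_right (hΔ _) hΔ0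
  have hB1 : ∑ a, ∑ b, ∑ c, same a (f a) * (same a b * same (f b) c) ≤ Δ ^ 2 * loops f := by
    simp_rw [← Finset.mul_sum, sum_same]
    exact hloop _ fun a => hbound _ a (fun _ => rfl) _ fun b => hΔ _
  have hB4 : ∑ a, ∑ b, ∑ c, same b (f b) * (same b a * same (f b) c) ≤ Δ ^ 2 * loops f := by
    rw [Finset.sum_comm]
    simp_rw [← Finset.mul_sum, sum_same]
    exact hloop _ fun b => hbound _ b (fun _ => rfl) _ fun a => hΔ _
  have hB6 : ∑ a, ∑ b, ∑ c, same c (f c) * (same (f b) c * same b a) ≤ Δ ^ 2 * loops f := by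
    have : ∑ a, ∑ b, ∑ c, same c (f c) * (same (f b) c * same b a) =
        ∑ c, same c (f c) * ∑ y, same y c * d (f y).1 := by
      rw [Finset.sum_comm]
      simp_rw [Finset.sum_comm (γ := HalfEdge n d) (f := fun a c => same c (f c) * _)]
      rw [Finset.sum_comm]
      simp_rw [← Finset.mul_sum, sum_same]
      refine Finset.sum_congr rfl fun c _ => ?_
      rw [← hf.sum_comp fun y => same y c * d (f y).1]
      simp_rw [hf.1]
    rw [this]
    exact hloop _ fun c => hbound _ c (fun _ => same_comm _ _) _ fun y => hΔ _
  have hdd : ∀ x y : HalfEdge n d, 0 ≤ same x y * distinct x y * same (f x) (f y) := fun x y =>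
    mul_nonneg (mul_nonneg (same_nonneg _ _) (distinct_nonneg _ _)) (same_nonneg _ _)
  have hB2 : ∑ a, ∑ b, ∑ c, same a b * distinct a b * same (f a) (f b) * same (f b) c ≤
      Δ * doubles f := by
    simp_rw [← Finset.mul_sum, sum_same, doubles, Finset.mul_sum]
    refine Finset.sum_le_sum fun a _ => Finset.sum_le_sum fun b _ => ?_
    rw [mul_comm]
    exact mul_le_mul_of_nonneg_right (hΔ _) (hdd a b)
  have hB5 : ∑ a, ∑ b, ∑ c, same (f b) c * distinct (f b) c * same b (f c) * same b a ≤
      Δ * doubles f := by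
    have : ∑ a, ∑ b, ∑ c, same (f b) c * distinct (f b) c * same b (f c) * same b a =
        ∑ y, ∑ c, same y c * distinct y c * same (f y) (f c) * d (f y).1 := by
      rw [Finset.sum_comm]
      rw [← hf.sum_comp fun y => ∑ c, same y c * distinct y c * same (f y) (f c) * d (f y).1]
      refine Finset.sum_congr rfl fun b _ => ?_
      rw [Finset.sum_comm]
      simp_rw [← Finset.mul_sum, sum_same, hf.1]
    rw [this]
    simp_rw [doubles, Finset.mul_sum]
    refine Finset.sum_le_sum fun a _ => Finset.sum_le_sum fun b _ => ?_
    rw [mul_comm]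
    exact mul_le_mul_of_nonneg_right (hΔ _) (hdd a b)
  have hlow : walks f ≤ m + (3 * Δ ^ 2 * loops f + 2 * Δ * doubles f + triangles f) := by
    rw [hcard, hW]
    refine (Finset.sum_le_sum fun a _ => Finset.sum_le_sum fun b _ => Finset.sum_le_sum fun c _ =>
      le_isPathThree_indicator_add hf a b c).trans ?_
    simp only [Finset.sum_add_distrib]
    unfold triangles
    linarith
  have hnum : (numP3 f : ℝ) = ((m / 2 : ℕ) : ℝ) := rfl
  rw [hnum]
  rw [abs_le] at hdiv ⊢
  constructor <;> linarith [hdiv.1, hdiv.2]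

/-- Markov's inequality for a uniformly random configuration. -/
lemma probConf_lt_abs_le (g : (HalfEdge n d → HalfEdge n d) → ℝ) {ε B : ℝ} (hε : 0 < ε)
    (hB : ∑ f ∈ configs n d, |g f| ≤ (configs n d).card * B)
    [DecidablePred fun f => ε < |g f|] :
    probConf n d (fun f => ε < |g f|) ≤ |B| / ε := by
  have hden : (∑ f : HalfEdge n d → HalfEdge n d, if IsConfig f then (1 : ℝ) else 0) =
      (configs n d).card := by simp [configs]
  have hnum : (∑ f : HalfEdge n d → HalfEdge n d,
      if IsConfig f ∧ ε < |g f| then (1 : ℝ) else 0) =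
      ∑ f ∈ configs n d, if ε < |g f| then (1 : ℝ) else 0 := by
    rw [configs, Finset.sum_filter]
    refine Finset.sum_congr rfl fun f _ => ?_
    by_cases h : IsConfig f <;> simp [h]
  have hle : (∑ f ∈ configs n d, if ε < |g f| then (1 : ℝ) else 0) * ε ≤
      (configs n d).card * |B| := by
    refine le_trans ?_ (hB.trans (mul_le_mul_of_nonneg_left (le_abs_self B) (Nat.cast_nonneg _)))
    rw [Finset.sum_mul]
    refine Finset.sum_le_sum fun f _ => ?_
    split_ifs with h
    · linarith
    · simp
  rw [probConf, hden, hnum]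
  rcases (Nat.cast_nonneg (α := ℝ) (configs n d).card).eq_or_lt with h0 | h0
  · rw [← h0, div_zero]
    positivity
  · rw [div_le_div_iff₀ h0 hε]
    linarith

lemma probConf_nonneg (P : (HalfEdge n d → HalfEdge n d) → Prop) [DecidablePred P] :
    0 ≤ probConf n d P :=
  div_nonneg (Finset.sum_nonneg fun _ _ => by split_ifs <;> norm_num)
    (Finset.sum_nonneg fun _ _ => by split_ifs <;> norm_num)

lemma cast_card_halfEdge : (Fintype.card (HalfEdge n d) : ℝ) = ∑ i, (d i : ℝ) := by
  simp [Fintype.card_sigma]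

lemma sum_degree_sub_one :
    ∑ x : HalfEdge n d, ((d x.1 : ℝ) - 1) = ∑ i, (d i : ℝ) ^ 2 - ∑ i, (d i : ℝ) := by
  rw [Finset.sum_sub_distrib, sum_halfEdge (d := d) (fun i => (d i : ℝ)), ← cast_card_halfEdge]
  simp [sq]

lemma sum_degree_sub_one_sq_le {Δ : ℝ} (hΔ : ∀ i, (d i : ℝ) ≤ Δ) :
    ∑ x : HalfEdge n d, ((d x.1 : ℝ) - 1) ^ 2 ≤ Δ * ∑ i, (d i : ℝ) ^ 2 := by
  simp_rw [sq]
  rw [← sum_halfEdge (d := d) (fun i => (d i : ℝ)), Finset.mul_sum]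
  refine Finset.sum_le_sum fun x _ => ?_
  have h0 := degree_sub_one_nonneg x
  have h1 := hΔ x.1
  exact mul_le_mul (by linarith) (by linarith) h0 (by linarith)

/-- Mean deviation bound for the number of paths with 2 edges. -/
lemma sum_abs_numP2_le {q p₁ p₃ s w δ : ℝ} (hq : 0 < q) (hp₁ : 0 < p₁) (hp₃ : 0 < p₃)
    (hn : (n : ℝ) = q ^ 2) (h₁ : ∑ i, (d i : ℝ) - 1 = p₁ * q ^ 2)
    (h₃ : ∑ i, (d i : ℝ) - 3 = p₃ * q ^ 2) (hs : ∑ i, (d i : ℝ) ^ 2 = s * q ^ 2)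
    (hw : ∑ i, (d i : ℝ) ^ 2 - ∑ i, (d i : ℝ) = w * q ^ 2)
    (hδ0 : 0 ≤ δ) (hδ : ∀ i, (d i : ℝ) ≤ δ * q) (ν : ℝ) :
    ∑ f ∈ configs n d, |(numP2 f : ℝ) / n - ν / 2| ≤ (configs n d).card *
      ((q⁻¹) ^ 2 + (2 * δ * s / p₁ * q⁻¹ + s ^ 2 / (p₁ * p₃) * q⁻¹ ^ 2 + s / p₁ * q⁻¹ ^ 2) / 2 +
        |w - ν| / 2) := by
  have hq2 : 0 < q ^ 2 := by positivity
  have hN3 : (3 : ℝ) < Fintype.card (HalfEdge n d) := by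
    rw [cast_card_halfEdge]
    have := mul_pos hp₃ hq2
    linarith
  have hL := sum_loops_le (d := d) (by linarith)
  have hD := sum_doubles_le hN3
  rw [cast_card_halfEdge, h₁, hs] at hL
  rw [cast_card_halfEdge, h₁, h₃, hs] at hD
  have hpt : ∀ f ∈ configs n d, |(numP2 f : ℝ) / n - ν / 2| ≤
      (1 / q ^ 2 + |w - ν| / 2) + δ / q * loops f + doubles f / (2 * q ^ 2) := by
    intro f _
    have h := abs_numP2_sub_le f hδ
    rw [sum_degree_sub_one, hw] at h
    have e : (numP2 f : ℝ) / n - ν / 2 =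
        ((numP2 f : ℝ) - w * q ^ 2 / 2) / q ^ 2 + (w - ν) / 2 := by
      rw [hn]; field_simp; ring
    rw [e]
    refine (abs_add_le _ _).trans ?_
    rw [abs_div, abs_div, abs_of_pos hq2, abs_of_pos (two_pos : (0 : ℝ) < 2)]
    have := div_le_div_of_nonneg_right h hq2.le
    refine (add_le_add_left this _).trans (le_of_eq ?_)
    field_simp
    ring
  refine (Finset.sum_le_sum hpt).trans ?_
  rw [Finset.sum_add_distrib, Finset.sum_add_distrib, Finset.sum_const, nsmul_eq_mul,
    ← Finset.mul_sum, ← Finset.sum_div]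
  have t1 := mul_le_mul_of_nonneg_left hL (by positivity : 0 ≤ δ / q)
  have t2 := div_le_div_of_nonneg_right hD (by positivity : 0 ≤ 2 * q ^ 2)
  refine (add_le_add (add_le_add_right t1 _) t2).trans (le_of_eq ?_)
  field_simp
  ring

/-- Mean deviation of the number of non-backtracking walks. -/
lemma sum_abs_walks_sub_le {q p₁ p₃ s w δ : ℝ} (hq : 0 < q) (hp₁ : 0 < p₁) (hp₃ : 0 < p₃)
    (h₁ : ∑ i, (d i : ℝ) - 1 = p₁ * q ^ 2)
    (h₃ : ∑ i, (d i : ℝ) - 3 = p₃ * q ^ 2) (hs : ∑ i, (d i : ℝ) ^ 2 = s * q ^ 2)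
    (hw : ∑ i, (d i : ℝ) ^ 2 - ∑ i, (d i : ℝ) = w * q ^ 2)
    (hδ : ∀ i, (d i : ℝ) ≤ δ * q) :
    ∑ f ∈ configs n d, |walks f - w ^ 2 / p₁ * q ^ 2| ≤ (configs n d).card * (q ^ 2 *
      √(w ^ 4 / (p₁ * p₃) - w ^ 4 / p₁ ^ 2 + 2 * (δ * s) ^ 2 / p₁ +
        2 * w ^ 2 * (δ * s) / p₁ ^ 2 * q⁻¹)) := by
  have hq2 : 0 < q ^ 2 := by positivity
  have hN3 : (3 : ℝ) < Fintype.card (HalfEdge n d) := by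
    rw [cast_card_halfEdge]
    have := mul_pos hp₃ hq2
    linarith
  set V := w ^ 4 / (p₁ * p₃) - w ^ 4 / p₁ ^ 2 + 2 * (δ * s) ^ 2 / p₁ +
    2 * w ^ 2 * (δ * s) / p₁ ^ 2 * q⁻¹ with hV
  have hQ := sum_degree_sub_one_sq_le hδ
  rw [hs] at hQ
  have hQ0 : 0 ≤ ∑ x : HalfEdge n d, ((d x.1 : ℝ) - 1) ^ 2 :=
    Finset.sum_nonneg fun _ _ => sq_nonneg _
  have h := sum_sq_walks_sub_le hN3 (w * q ^ 2) _ (sum_degree_sub_one.trans hw) rfl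
  rw [cast_card_halfEdge, h₁, h₃] at h
  set Q := ∑ x : HalfEdge n d, ((d x.1 : ℝ) - 1) ^ 2
  have hc : (w * q ^ 2) ^ 2 / (p₁ * q ^ 2) = w ^ 2 / p₁ * q ^ 2 := by field_simp
  rw [hc] at h
  have hbr : (w * q ^ 2) ^ 4 / (p₁ * q ^ 2 * (p₃ * q ^ 2)) -
      (w * q ^ 2) ^ 4 / (p₁ * q ^ 2) ^ 2 + 2 * Q ^ 2 / (p₁ * q ^ 2) +
      2 * (w * q ^ 2) ^ 2 * Q / (p₁ * q ^ 2) ^ 2 ≤ (q ^ 2) ^ 2 * V := by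
    calc _ ≤ (w * q ^ 2) ^ 4 / (p₁ * q ^ 2 * (p₃ * q ^ 2)) -
      (w * q ^ 2) ^ 4 / (p₁ * q ^ 2) ^ 2 + 2 * (δ * q * (s * q ^ 2)) ^ 2 / (p₁ * q ^ 2) +
      2 * (w * q ^ 2) ^ 2 * (δ * q * (s * q ^ 2)) / (p₁ * q ^ 2) ^ 2 := by gcongr
      _ = _ := by
        rw [hV]
        field_simp
  have hCS := sq_sum_le_card_mul_sum_sq (s := configs n d)
    (f := fun f => |walks f - w ^ 2 / p₁ * q ^ 2|)
  simp only [sq_abs] at hCS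
  have hfin : (∑ f ∈ configs n d, |walks f - w ^ 2 / p₁ * q ^ 2|) ^ 2 ≤
      ((configs n d).card * q ^ 2) ^ 2 * V := by
    calc _ ≤ _ := hCS
      _ ≤ (configs n d).card * ((configs n d).card * ((q ^ 2) ^ 2 * V)) :=
        mul_le_mul_of_nonneg_left
          (h.trans (mul_le_mul_of_nonneg_left hbr (Nat.cast_nonneg _))) (Nat.cast_nonneg _)
      _ = _ := by ring
  have := Real.le_sqrt_of_sq_le hfin
  rwa [Real.sqrt_mul (sq_nonneg _), Real.sqrt_sq (by positivity), mul_assoc] at this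

/-- Mean deviation bound for the number of paths with 3 edges. -/
lemma sum_abs_numP3_le {q p₁ p₃ p₅ s w δ : ℝ} (hq : 0 < q) (hp₁ : 0 < p₁) (hp₃ : 0 < p₃)
    (hp₅ : 0 < p₅) (hn : (n : ℝ) = q ^ 2) (h₁ : ∑ i, (d i : ℝ) - 1 = p₁ * q ^ 2)
    (h₃ : ∑ i, (d i : ℝ) - 3 = p₃ * q ^ 2) (h₅ : ∑ i, (d i : ℝ) - 5 = p₅ * q ^ 2)
    (hs : ∑ i, (d i : ℝ) ^ 2 = s * q ^ 2)
    (hw : ∑ i, (d i : ℝ) ^ 2 - ∑ i, (d i : ℝ) = w * q ^ 2)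
    (hδ0 : 0 ≤ δ) (hδ : ∀ i, (d i : ℝ) ≤ δ * q) (L : ℝ) :
    ∑ f ∈ configs n d, |(numP3 f : ℝ) / n - L| ≤ (configs n d).card *
      (q⁻¹ ^ 2 + (3 * δ ^ 2 * s / p₁ + 2 * δ * s ^ 2 / (p₁ * p₃) * q⁻¹ + 2 * δ * s / p₁ * q⁻¹ +
          s ^ 3 / (p₁ * p₃ * p₅) * q⁻¹ ^ 2) / 2 +
        √(w ^ 4 / (p₁ * p₃) - w ^ 4 / p₁ ^ 2 + 2 * (δ * s) ^ 2 / p₁ +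
          2 * w ^ 2 * (δ * s) / p₁ ^ 2 * q⁻¹) / 2 +
        |w ^ 2 / (2 * p₁) - L|) := by
  have hq2 : 0 < q ^ 2 := by positivity
  have hN5 : (5 : ℝ) < Fintype.card (HalfEdge n d) := by
    rw [cast_card_halfEdge]
    have := mul_pos hp₅ hq2
    linarith
  have hL := sum_loops_le (d := d) (by linarith)
  have hD := sum_doubles_le (d := d) (by linarith)
  have hT := sum_triangles_le hN5
  have hV := sum_abs_walks_sub_le hq hp₁ hp₃ h₁ h₃ hs hw hδ
  set R := √(w ^ 4 / (p₁ * p₃) - w ^ 4 / p₁ ^ 2 + 2 * (δ * s) ^ 2 / p₁ +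
          2 * w ^ 2 * (δ * s) / p₁ ^ 2 * q⁻¹)
  rw [cast_card_halfEdge, h₁, hs] at hL
  rw [cast_card_halfEdge, h₁, h₃, hs] at hD
  rw [cast_card_halfEdge, h₁, h₃, h₅, hs] at hT
  have hpt : ∀ f ∈ configs n d, |(numP3 f : ℝ) / n - L| ≤
      (1 / q ^ 2 + |w ^ 2 / (2 * p₁) - L|) + 3 * δ ^ 2 / 2 * loops f + δ / q * doubles f +
        triangles f / (2 * q ^ 2) + |walks f - w ^ 2 / p₁ * q ^ 2| / (2 * q ^ 2) := by
    intro f hf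
    have h := abs_numP3_sub_le (mem_configs.1 hf) (by positivity) hδ
    have e : (numP3 f : ℝ) / n - L =
        ((numP3 f : ℝ) - walks f / 2) / q ^ 2 + (walks f - w ^ 2 / p₁ * q ^ 2) / (2 * q ^ 2) +
          (w ^ 2 / (2 * p₁) - L) := by
      rw [hn]; field_simp; ring
    rw [e]
    refine ((abs_add_le _ _).trans (add_le_add_left (abs_add_le _ _) _)).trans ?_
    rw [abs_div, abs_div, abs_of_pos hq2, abs_of_pos (by positivity : 0 < 2 * q ^ 2)]
    have := div_le_div_of_nonneg_right h hq2.le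
    refine (add_le_add_left (add_le_add_left this _) _).trans (le_of_eq ?_)
    field_simp
    ring
  refine (Finset.sum_le_sum hpt).trans ?_
  simp only [Finset.sum_add_distrib, Finset.sum_const, nsmul_eq_mul, ← Finset.mul_sum,
    ← Finset.sum_div]
  have t1 := mul_le_mul_of_nonneg_left hL (by positivity : 0 ≤ 3 * δ ^ 2 / 2)
  have t2 := mul_le_mul_of_nonneg_left hD (by positivity : 0 ≤ δ / q)
  have t3 := div_le_div_of_nonneg_right hT (by positivity : 0 ≤ 2 * q ^ 2)
  have t4 := div_le_div_of_nonneg_right hV (by positivity : 0 ≤ 2 * q ^ 2)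
  refine (add_le_add (add_le_add (add_le_add (add_le_add le_rfl t1) t2) t3) t4).trans
    (le_of_eq ?_)
  field_simp
  ring

end Configurations

lemma tendsto_numP2_bound {r δ s w p₁ p₃ : ℕ → ℝ} {μ μ₂ ν : ℝ} (hμ : μ ≠ 0)
    (hr : Tendsto r atTop (nhds 0)) (hδ : Tendsto δ atTop (nhds 0))
    (hs : Tendsto s atTop (nhds μ₂)) (hw : Tendsto w atTop (nhds ν))
    (hp₁ : Tendsto p₁ atTop (nhds μ)) (hp₃ : Tendsto p₃ atTop (nhds μ)) :
    Tendsto (fun n => r n ^ 2 + (2 * δ n * s n / p₁ n * r n + s n ^ 2 / (p₁ n * p₃ n) * r n ^ 2 +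
      s n / p₁ n * r n ^ 2) / 2 + |w n - ν| / 2) atTop (nhds 0) := by
  have hμμ : μ * μ ≠ 0 := mul_ne_zero hμ hμ
  have key := ((hr.pow 2).add ((((((hδ.const_mul 2).mul hs).div hp₁ hμ).mul hr).add
    (((hs.pow 2).div (hp₁.mul hp₃) hμμ).mul (hr.pow 2))).add
    ((hs.div hp₁ hμ).mul (hr.pow 2)) |>.div_const 2)).add ((hw.sub_const ν).abs.div_const 2)
  simpa using key

lemma tendsto_numP3_bound {r δ s w p₁ p₃ p₅ : ℕ → ℝ} {μ μ₂ ν : ℝ} (hμ : μ ≠ 0)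
    (hr : Tendsto r atTop (nhds 0)) (hδ : Tendsto δ atTop (nhds 0))
    (hs : Tendsto s atTop (nhds μ₂)) (hw : Tendsto w atTop (nhds ν))
    (hp₁ : Tendsto p₁ atTop (nhds μ)) (hp₃ : Tendsto p₃ atTop (nhds μ))
    (hp₅ : Tendsto p₅ atTop (nhds μ)) :
    Tendsto (fun n => r n ^ 2 + (3 * δ n ^ 2 * s n / p₁ n +
      2 * δ n * s n ^ 2 / (p₁ n * p₃ n) * r n + 2 * δ n * s n / p₁ n * r n +
      s n ^ 3 / (p₁ n * p₃ n * p₅ n) * r n ^ 2) / 2 +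
      √(w n ^ 4 / (p₁ n * p₃ n) - w n ^ 4 / p₁ n ^ 2 + 2 * (δ n * s n) ^ 2 / p₁ n +
        2 * w n ^ 2 * (δ n * s n) / p₁ n ^ 2 * r n) / 2 +
      |w n ^ 2 / (2 * p₁ n) - ν ^ 2 / (2 * μ)|) atTop (nhds 0) := by
  have hμμ : μ * μ ≠ 0 := mul_ne_zero hμ hμ
  have hμ2 : μ ^ 2 ≠ 0 := pow_ne_zero 2 hμ
  have main : Tendsto (fun n => r n ^ 2 + (3 * δ n ^ 2 * s n / p₁ n +
      2 * δ n * s n ^ 2 / (p₁ n * p₃ n) * r n + 2 * δ n * s n / p₁ n * r n +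
      s n ^ 3 / (p₁ n * p₃ n * p₅ n) * r n ^ 2) / 2) atTop (nhds 0) := by
    have key := (hr.pow 2).add (((((((hδ.pow 2).const_mul 3).mul hs).div hp₁ hμ).add
      ((((hδ.const_mul 2).mul (hs.pow 2)).div (hp₁.mul hp₃) hμμ).mul hr)).add
      ((((hδ.const_mul 2).mul hs).div hp₁ hμ).mul hr)).add
      (((hs.pow 3).div ((hp₁.mul hp₃).mul hp₅) (mul_ne_zero hμμ hμ)).mul (hr.pow 2))
      |>.div_const 2)
    simpa using key
  have deviation : Tendsto (fun n => √(w n ^ 4 / (p₁ n * p₃ n) - w n ^ 4 / p₁ n ^ 2 +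
      2 * (δ n * s n) ^ 2 / p₁ n + 2 * w n ^ 2 * (δ n * s n) / p₁ n ^ 2 * r n) / 2)
      atTop (nhds 0) := by
    have key := (((((hw.pow 4).div (hp₁.mul hp₃) hμμ).sub
      ((hw.pow 4).div (hp₁.pow 2) hμ2)).add
      ((((hδ.mul hs).pow 2).const_mul 2).div hp₁ hμ)).add
      (((((hw.pow 2).const_mul 2).mul (hδ.mul hs)).div (hp₁.pow 2) hμ2).mul hr)).sqrt.div_const 2
    simpa [sq] using key
  have mean : Tendsto (fun n => |w n ^ 2 / (2 * p₁ n) - ν ^ 2 / (2 * μ)|) atTop (nhds 0) := by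
    have key := (((hw.pow 2).div (hp₁.const_mul 2) (mul_ne_zero two_ne_zero hμ)).sub_const
      (ν ^ 2 / (2 * μ))).abs
    simpa using key
  simpa using (main.add deviation).add mean

/-- Assume `(1/n) ∑ d i → μ > 0`, `(1/n) ∑ d i² → μ₂ < ∞` and `max d i = o(√n)`, and
let `ν = μ₂ - μ`.  Then `X₂/n → ν/2` and `X₃/n → ν²/(2μ)` in probability. -/
theorem path_counts_lln
    (d : (n : ℕ) → Fin n → ℕ) (hEven : ∀ n, Even (∑ i, d n i))
    (μ μ₂ : ℝ) (hμ : 0 < μ)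
    (h1 : Tendsto (fun n : ℕ => (∑ i, (d n i : ℝ)) / n) atTop (nhds μ))
    (h2 : Tendsto (fun n : ℕ => (∑ i, (d n i : ℝ) ^ 2) / n) atTop (nhds μ₂))
    (hmax : Tendsto (fun n : ℕ => ((Finset.univ.sup (d n) : ℕ) : ℝ) / Real.sqrt n)
      atTop (nhds 0)) :
    ∀ ε : ℝ, 0 < ε →
      Tendsto (fun n => probConf n (d n)
          (fun f => ε < |(numP2 f : ℝ) / n - (μ₂ - μ) / 2|)) atTop (nhds 0) ∧
      Tendsto (fun n => probConf n (d n)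
          (fun f => ε < |(numP3 f : ℝ) / n - (μ₂ - μ) ^ 2 / (2 * μ)|)) atTop (nhds 0) := by
  intro ε hε
  have hr : Tendsto (fun n : ℕ => (√(n : ℝ))⁻¹) atTop (nhds 0) :=
    tendsto_inv_atTop_zero.comp (Real.tendsto_sqrt_atTop.comp tendsto_natCast_atTop_atTop)
  have hw : Tendsto (fun n : ℕ => (∑ i, (d n i : ℝ) ^ 2) / n - (∑ i, (d n i : ℝ)) / n)
      atTop (nhds (μ₂ - μ)) := h2.sub h1
  have hp (c : ℝ) : Tendsto (fun n : ℕ => (∑ i, (d n i : ℝ) - c) / n) atTop (nhds μ) := by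
    simpa [sub_div] using h1.sub (tendsto_const_div_atTop_nhds_zero_nat c)
  have hpos (c : ℝ) : ∀ᶠ n : ℕ in atTop, 0 < (∑ i, (d n i : ℝ) - c) / n :=
    (hp c).eventually (lt_mem_nhds hμ)
  have hmul (n : ℕ) (hn : 0 < n) (x : ℝ) : x = x / n * √(n : ℝ) ^ 2 := by
    rw [Real.sq_sqrt n.cast_nonneg, div_mul_cancel₀]
    positivity
  have hdeg (n : ℕ) (hn : 0 < n) (i : Fin n) :
      (d n i : ℝ) ≤ ((Finset.univ.sup (d n) : ℕ) : ℝ) / √(n : ℝ) * √(n : ℝ) := by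
    rw [div_mul_cancel₀ _ (by positivity)]
    exact_mod_cast Finset.le_sup (f := d n) (Finset.mem_univ i)
  have hlim {B : ℕ → ℝ} (hB : Tendsto B atTop (nhds 0)) :
      Tendsto (fun n => |B n| / ε) atTop (nhds 0) := by
    simpa using hB.abs.div_const ε
  constructor
  · refine squeeze_zero' (.of_forall fun n => probConf_nonneg _) ?_
      (hlim (tendsto_numP2_bound hμ.ne' hr hmax h2 hw (hp 1) (hp 3)))
    filter_upwards [eventually_gt_atTop 0, hpos 1, hpos 3] with n hn h₁ h₃
    exact probConf_lt_abs_le _ hε (sum_abs_numP2_le (by positivity) h₁ h₃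
      (Real.sq_sqrt n.cast_nonneg).symm (hmul n hn _) (hmul n hn _) (hmul n hn _)
      (by rw [← sub_div]; exact hmul n hn _) (by positivity) (hdeg n hn) _)
  · refine squeeze_zero' (.of_forall fun n => probConf_nonneg _) ?_
      (hlim (tendsto_numP3_bound hμ.ne' hr hmax h2 hw (hp 1) (hp 3) (hp 5)))
    filter_upwards [eventually_gt_atTop 0, hpos 1, hpos 3, hpos 5] with n hn h₁ h₃ h₅
    exact probConf_lt_abs_le _ hε (sum_abs_numP3_le (by positivity) h₁ h₃ h₅
      (Real.sq_sqrt n.cast_nonneg).symm (hmul n hn _) (hmul n hn _) (hmul n hn _) (hmul n hn _)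
      (by rw [← sub_div]; exact hmul n hn _) (by positivity) (hdeg n hn) _)
end
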